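/- The set 𝓔 of exhaustive submeasures on ℬ, regarded as a subset of the product space [0,∞]^ℬ with the product topology, is not a Borel set. -/

import Mathlib

open Ordinal Filter
open scoped ENNReal

/-- The space `T = ∏ₙ 2ⁿ`. -/
abbrev TT : Type := (n : ℕ) → Fin (2 ^ n)

/-- The Boolean algebra `ℬ` of clopen subsets of `T`. -/
abbrev BAlg := {X : Set TT // IsClopen X}

/-- `f : ℬ → [0,∞]` is a submeasure: it vanishes on `∅`, and is monotone and
subadditive. -/
def IsSubmeasurePt (f : BAlg → ℝ≥0∞) : Prop :=
  f ⟨∅, isClopen_empty⟩ = 0 ∧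
    (∀ X Y : BAlg, X.1 ⊆ Y.1 → f X ≤ f Y) ∧
    (∀ X Y : BAlg, f ⟨X.1 ∪ Y.1, X.2.union Y.2⟩ ≤ f X + f Y)

/-- `f` is exhaustive: along every pairwise disjoint sequence in `ℬ`, `f` tends to `0`. -/
def IsExhaustivePt (f : BAlg → ℝ≥0∞) : Prop :=
  ∀ E : ℕ → BAlg, (∀ i j, i ≠ j → Disjoint (E i).1 (E j).1) →
    Filter.Tendsto (fun i => f (E i)) Filter.atTop (nhds 0)

namespace Tal
open Classical
open scoped NNReal

/-- Weighted sets. -/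
abbrev El := Set TT × Finset ℕ × ℝ≥0

def spl (m : ℕ) (z x : TT) : TT := fun i => if i < m then z i else x i

def Free (a b : ℕ) (z : TT) (X : Set TT) : Set TT :=
  {x | ∀ y : TT, (∀ i, i < a → y i = z i) → (∀ i, a ≤ i → i < b → y i = x i) → y ∉ X}

noncomputable def phi (C : Set El) (B : Set TT) : ℝ≥0∞ :=
  ⨅ (F : Finset El) (_ : ∀ e ∈ F, e ∈ C) (_ : ∀ x ∈ B, ∃ e ∈ F, x ∈ e.1),
    ((∑ e ∈ F, e.2.2 : ℝ≥0) : ℝ≥0∞)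

lemma phi_le (C : Set El) (B : Set TT) (F : Finset El) (h1 : ∀ e ∈ F, e ∈ C)
    (h2 : ∀ x ∈ B, ∃ e ∈ F, x ∈ e.1) : phi C B ≤ ((∑ e ∈ F, e.2.2 : ℝ≥0) : ℝ≥0∞) :=
  iInf_le_of_le F (iInf_le_of_le h1 (iInf_le_of_le h2 le_rfl))

lemma phi_le_fam {ι : Type*} (C : Set El) (B : Set TT) (s : Finset ι) (f : ι → El)
    (h1 : ∀ i ∈ s, f i ∈ C) (h2 : ∀ x ∈ B, ∃ i ∈ s, x ∈ (f i).1) :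
    phi C B ≤ ((∑ i ∈ s, (f i).2.2 : ℝ≥0) : ℝ≥0∞) := by
  refine (phi_le C B (s.image f) ?_ ?_).trans ?_
  · intro e he
    obtain ⟨i, hi, rfl⟩ := Finset.mem_image.1 he
    exact h1 i hi
  · intro x hx
    obtain ⟨i, hi, h⟩ := h2 x hx
    exact ⟨f i, Finset.mem_image_of_mem f hi, h⟩
  · exact_mod_cast Finset.sum_image_le_of_nonneg (s := s) (g := f) (f := fun e : El => e.2.2) (fun _ _ => zero_le)

lemma exists_of_phi_lt {C : Set El} {B : Set TT} {c : ℝ≥0∞} (h : phi C B < c) :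
    ∃ F : Finset El, (∀ e ∈ F, e ∈ C) ∧ (∀ x ∈ B, ∃ e ∈ F, x ∈ e.1) ∧
      ((∑ e ∈ F, e.2.2 : ℝ≥0) : ℝ≥0∞) < c := by
  simp only [phi, iInf_lt_iff] at h
  obtain ⟨F, h1, h2, h3⟩ := h
  exact ⟨F, h1, h2, h3⟩

lemma phi_empty (C : Set El) : phi C ∅ = 0 := by
  have := phi_le C ∅ ∅ (by simp) (by simp)
  simpa using this

lemma phi_mono (C : Set El) {A B : Set TT} (h : A ⊆ B) : phi C A ≤ phi C B := by
  refine le_iInf fun F => le_iInf fun h1 => le_iInf fun h2 => ?_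
  exact phi_le C A F h1 (fun x hx => h2 x (h hx))

lemma phi_anti {C D : Set El} (h : C ⊆ D) (B : Set TT) : phi D B ≤ phi C B := by
  refine le_iInf fun F => le_iInf fun h1 => le_iInf fun h2 => ?_
  exact phi_le D B F (fun e he => h (h1 e he)) h2

lemma phi_union (C : Set El) (A B : Set TT) : phi C (A ∪ B) ≤ phi C A + phi C B := by
  refine le_of_forall_gt fun c hc => ?_
  obtain ⟨a, b, ha, hb, hab⟩ : ∃ a b, phi C A < a ∧ phi C B < b ∧ a + b ≤ c := by
    obtain ⟨a, ha, b, hb, h⟩ := ENNReal.exists_add_lt_of_add_lt hc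
    exact ⟨a, b, ha, hb, h.le⟩
  obtain ⟨F, f1, f2, f3⟩ := exists_of_phi_lt ha
  obtain ⟨G, g1, g2, g3⟩ := exists_of_phi_lt hb
  refine lt_of_le_of_lt (phi_le C _ (F ∪ G) ?_ ?_) (lt_of_le_of_lt ?_ (lt_of_lt_of_le (ENNReal.add_lt_add f3 g3) hab))
  · intro e he
    rcases Finset.mem_union.1 he with h | h
    exacts [f1 e h, g1 e h]
  · rintro x (hx | hx)
    · obtain ⟨e, he, h⟩ := f2 x hx
      exact ⟨e, Finset.mem_union_left _ he, h⟩
    · obtain ⟨e, he, h⟩ := g2 x hx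
      exact ⟨e, Finset.mem_union_right _ he, h⟩
  · rw [← ENNReal.coe_add]
    have := Finset.sum_union_inter (s₁ := F) (s₂ := G) (f := fun e : El => e.2.2)
    rw [← this]
    exact_mod_cast le_self_add

def bet (k : ℕ) : ℕ := 2 ^ (k + 2) * (k + 9)

def NN (k : ℕ) : ℕ := (2 ^ k * 8) ^ bet k * (128 * 2 ^ k + 2)

def Ek (nm : Finset ℕ → ℕ) (k : ℕ) (ν : Set TT → ℝ≥0∞) : Set El :=
  {e | 1 ≤ 2 ^ k * e.2.2 ∧ ((NN k : ℕ) : ℝ≥0) ≤ (nm e.2.1 : ℝ≥0) * (2 ^ k * e.2.2) ^ bet k ∧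
    ∀ m ∈ e.2.1, ∀ n ∈ e.2.1, m < n → ∀ z, 1 ≤ ν (Free m n z e.1)}

noncomputable def Cl (nm : Finset ℕ → ℕ) : ℕ → ℕ → Set El
  | 0, _ => ∅
  | j + 1, k => Cl nm j (k + 1) ∪ Ek nm k (phi (Cl nm j (k + 1)))

lemma free_free {a b m n : ℕ} (ha : a ≤ m) (hmn : m < n) (hb : n ≤ b) (z z' : TT) (X : Set TT) :
    Free m n (spl a z z') X ⊆ Free m n z' (Free a b z X)ᶜ := by
  intro x hx y hy1 hy2 hy
  apply hy
  intro y' h1 h2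
  apply hx
  · intro i hi
    by_cases h : i < a
    · simp [spl, h, h1 i h]
    · push Not at h
      rw [h2 i h (by omega), hy1 i hi]
      simp [spl, h]
  · intro i hi hin
    rw [h2 i (by omega) (by omega), hy2 i hi hin]

/-- Restriction of an element to a block of coordinates. -/
noncomputable def res (a b : ℕ) (z : TT) (r : ℝ≥0) (e : El) : El :=
  ((Free a b z e.1)ᶜ, e.2.1.filter (fun i => a ≤ i ∧ i < b), r * e.2.2)

lemma res_mem (nm : Finset ℕ → ℕ) (a b : ℕ) (z : TT) (r : ℝ≥0) (hr : 1 ≤ r) (P : ℕ) :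
    ∀ (j k : ℕ), (∀ k', k ≤ k' → (P : ℝ≥0) ≤ r ^ bet k') → ∀ e ∈ Cl nm j k,
      nm e.2.1 ≤ P * nm (e.2.1.filter (fun i => a ≤ i ∧ i < b)) → res a b z r e ∈ Cl nm j k := by
  intro j
  induction j with
  | zero => intro k _ e he; simp [Cl] at he
  | succ j ih =>
    intro k hP e he hn
    rcases he with he | he
    · exact Or.inl (ih (k + 1) (fun k' hk' => hP k' (by omega)) e he hn)
    · refine Or.inr ?_
      obtain ⟨h1, h2, h3⟩ := he
      refine ⟨?_, ?_, ?_⟩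
      · simp only [res]
        calc (1 : ℝ≥0) ≤ 2 ^ k * e.2.2 := h1
          _ ≤ 2 ^ k * (r * e.2.2) := by gcongr; exact le_mul_of_one_le_left zero_le hr
      · simp only [res]
        calc ((NN k : ℕ) : ℝ≥0) ≤ (nm e.2.1 : ℝ≥0) * (2 ^ k * e.2.2) ^ bet k := h2
          _ ≤ ((P * nm (e.2.1.filter (fun i => a ≤ i ∧ i < b)) : ℕ) : ℝ≥0) * (2 ^ k * e.2.2) ^ bet k := by
              gcongr
          _ = (nm (e.2.1.filter (fun i => a ≤ i ∧ i < b)) : ℝ≥0) * (P * (2 ^ k * e.2.2) ^ bet k) := by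
              push_cast; ring
          _ ≤ (nm (e.2.1.filter (fun i => a ≤ i ∧ i < b)) : ℝ≥0) * (r ^ bet k * (2 ^ k * e.2.2) ^ bet k) := by
              gcongr; exact hP k le_rfl
          _ = _ := by rw [← mul_pow]; congr 2; ring
      · intro m hm n hn hmn z'
        simp only [res, Finset.mem_filter] at hm hn ⊢
        exact (h3 m hm.1 n hn.1 hmn (spl a z z')).trans
          (phi_mono _ (free_free hm.2.1 hmn hn.2.2.le z z' e.1))

lemma mem_res {a b : ℕ} {z x : TT} {r : ℝ≥0} {e : El} :
    x ∉ (res a b z r e).1 ↔ x ∈ Free a b z e.1 := by simp [res]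

/-- good gaps of `I` avoiding `G`. -/
noncomputable def gd (G I : Finset ℕ) : Finset (ℕ × ℕ) :=
  (I ×ˢ I).filter (fun p => p.1 < p.2 ∧ (∀ c ∈ I, ¬ (p.1 < c ∧ c < p.2)) ∧
    ∀ g ∈ G, ¬ (p.1 ≤ g ∧ g < p.2))

structure NormOK (nm : Finset ℕ → ℕ) (GG : Set (Finset ℕ)) : Prop where
  mono : ∀ I J, I ⊆ J → nm I ≤ nm J
  sub : ∀ I J, nm (I ∪ J) ≤ nm I + nm J
  card : ∀ I, nm I ≤ I.card
  good : ∀ G ∈ GG, ∀ I, nm I ≤ (gd G I).card + 2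
  emp : ∅ ∈ GG

def Dj (p q : ℕ × ℕ) : Prop := p.2 ≤ q.1 ∨ q.2 ≤ p.1

lemma select {ι : Type*} (t : ℕ) : ∀ (n : ℕ) (S : Finset ι), S.card = n → ∀ (g : ι → Finset (ℕ × ℕ)),
    (∀ l ∈ S, n * t ≤ (g l).card) → (∀ l ∈ S, ∀ p ∈ g l, p.1 < p.2) →
    (∀ l ∈ S, ∀ p ∈ g l, ∀ q ∈ g l, p ≠ q → Dj p q) →
    ∃ U : ι → Finset (ℕ × ℕ), (∀ l ∈ S, U l ⊆ g l) ∧ (∀ l ∈ S, (U l).card = t) ∧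
      ∀ l ∈ S, ∀ l' ∈ S, ∀ p ∈ U l, ∀ q ∈ U l', (l ≠ l' ∨ p ≠ q) → Dj p q := by
  intro n
  induction n with
  | zero =>
    intro S hS g _ _ _
    rw [Finset.card_eq_zero] at hS
    subst hS
    exact ⟨fun _ => ∅, by simp, by simp, by simp⟩
  | succ n ih =>
    intro S hS g hc hlt hdj
    have hne : S.Nonempty := by rw [← Finset.card_pos]; omega
    have hex : ∃ v, ∃ l ∈ S, t ≤ ((g l).filter (fun p => p.2 ≤ v)).card := by
      obtain ⟨l, hl⟩ := hne
      refine ⟨(g l).sup (fun p => p.2), l, hl, ?_⟩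
      rw [Finset.filter_true_of_mem]
      · have := hc l hl; nlinarith
      · intro p hp; exact Finset.le_sup (f := fun p : ℕ × ℕ => p.2) hp
    obtain ⟨l, hl, hlv⟩ := Nat.find_spec hex
    set v := Nat.find hex with hv
    have hmin : ∀ u < v, ∀ l' ∈ S, ((g l').filter (fun p => p.2 ≤ u)).card < t := by
      intro u hu l' hl'
      by_contra hcon
      push Not at hcon
      exact Nat.find_min hex hu ⟨l', hl', hcon⟩
    obtain ⟨U0, hU0, hU0c⟩ := Finset.exists_subset_card_eq hlv
    have key : ∀ l' ∈ S.erase l, n * t ≤ ((g l').filter (fun p => v ≤ p.1)).card := by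
      intro l' hl'
      have hl'S := Finset.mem_of_mem_erase hl'
      have h1 := hc l' hl'S
      have h2 : ((g l').filter (fun p => ¬ v ≤ p.1)).card ≤ t := by
        rcases Nat.eq_zero_or_pos v with h0 | h0
        · simp [h0]
        have h3 := hmin (v - 1) (by omega) l' hl'S
        have h4 : ((g l').filter (fun p => p.1 < v ∧ v ≤ p.2)).card ≤ 1 := by
          rw [Finset.card_le_one]
          intro p hp q hq
          simp only [Finset.mem_filter] at hp hq
          by_contra hpq
          have := hdj l' hl'S p hp.1 q hq.1 hpq
          unfold Dj at this
          omega
        have h5 : (g l').filter (fun p => ¬ v ≤ p.1) ⊆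
            (g l').filter (fun p => p.2 ≤ v - 1) ∪ (g l').filter (fun p => p.1 < v ∧ v ≤ p.2) := by
          intro p hp
          simp only [Finset.mem_filter, Finset.mem_union] at hp ⊢
          by_cases h : p.2 ≤ v - 1
          · exact Or.inl ⟨hp.1, h⟩
          · exact Or.inr ⟨hp.1, by omega, by omega⟩
        have h6 := (Finset.card_le_card h5).trans (Finset.card_union_le _ _)
        omega
      have h7 := Finset.card_filter_add_card_filter_not (s := g l') (fun p => v ≤ p.1)
      have : (n + 1) * t = n * t + t := by ring
      omega
    obtain ⟨U, u1, u2, u3⟩ := ih (S.erase l) (by rw [Finset.card_erase_of_mem hl]; omega)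
      (fun l' => (g l').filter (fun p => v ≤ p.1)) key
      (fun l' hl' p hp => hlt l' (Finset.mem_of_mem_erase hl') p (Finset.mem_filter.1 hp).1)
      (fun l' hl' p hp q hq => hdj l' (Finset.mem_of_mem_erase hl') p (Finset.mem_filter.1 hp).1 q
        (Finset.mem_filter.1 hq).1)
    have hU0m : ∀ p ∈ U0, p ∈ g l ∧ p.2 ≤ v := fun p hp => Finset.mem_filter.1 (hU0 hp)
    have hUm : ∀ l' ∈ S, l' ≠ l → ∀ p ∈ U l', p ∈ g l' ∧ v ≤ p.1 := fun l' hl' hne p hp =>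
      Finset.mem_filter.1 (u1 l' (Finset.mem_erase.2 ⟨hne, hl'⟩) hp)
    refine ⟨fun l' => if l' = l then U0 else U l', ?_, ?_, ?_⟩
    · intro l' hl'
      by_cases h : l' = l
      · subst h; simp only [if_true]; exact fun p hp => (hU0m p hp).1
      · simp only [h, if_false]; exact fun p hp => (hUm l' hl' h p hp).1
    · intro l' hl'
      by_cases h : l' = l
      · simp [h, hU0c]
      · simp only [h, if_false]; exact u2 l' (Finset.mem_erase.2 ⟨h, hl'⟩)
    · intro l1 h1 l2 h2 p hp q hq hpq
      by_cases e1 : l1 = l <;> by_cases e2 : l2 = l <;> simp only [e1, e2, if_true, if_false] at hp hq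
      · refine hdj l hl p (hU0m p hp).1 q (hU0m q hq).1 ?_
        rcases hpq with h | h
        · exact absurd (e1.trans e2.symm) h
        · exact h
      · exact Or.inl ((hU0m p hp).2.trans (hUm l2 h2 e2 q hq).2)
      · exact Or.inr ((hU0m q hq).2.trans (hUm l1 h1 e1 p hp).2)
      · exact u3 l1 (Finset.mem_erase.2 ⟨e1, h1⟩) l2 (Finset.mem_erase.2 ⟨e2, h2⟩) p hp q hq hpq

lemma gd_spec {G I : Finset ℕ} {p : ℕ × ℕ} (h : p ∈ gd G I) :
    p.1 ∈ I ∧ p.2 ∈ I ∧ p.1 < p.2 ∧ ∀ g ∈ G, ¬ (p.1 ≤ g ∧ g < p.2) := by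
  simp only [gd, Finset.mem_filter, Finset.mem_product] at h
  tauto

lemma gd_dj {G I : Finset ℕ} {p q : ℕ × ℕ} (hp : p ∈ gd G I) (hq : q ∈ gd G I) (h : p ≠ q) :
    Dj p q := by
  simp only [gd, Finset.mem_filter, Finset.mem_product] at hp hq
  have a1 := hp.2.2.1 q.1 hq.1.1
  have a2 := hp.2.2.1 q.2 hq.1.2
  have a3 := hq.2.2.1 p.1 hp.1.1
  have a4 := hq.2.2.1 p.2 hp.1.2
  unfold Dj
  have : p.1 ≠ q.1 ∨ p.2 ≠ q.2 := by
    by_contra hc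
    push Not at hc
    exact h (Prod.ext hc.1 hc.2)
  omega

lemma nm_biUnion {nm : Finset ℕ → ℕ} {GG} (h : NormOK nm GG) {ι : Type*} (D : Finset ι)
    (f : ι → Finset ℕ) : nm (D.biUnion f) ≤ ∑ d ∈ D, nm (f d) := by
  induction D using Finset.induction_on with
  | empty => simpa using h.card ∅
  | insert a s ha ih =>
    rw [Finset.biUnion_insert, Finset.sum_insert ha]
    exact (h.sub _ _).trans (by omega)

lemma bern (K L : ℕ) : ((2 ^ L : ℕ) : ℝ≥0) ≤ (1 + (2 ^ K)⁻¹) ^ (2 ^ K * L) := by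
  rw [pow_mul]
  push_cast
  gcongr
  have := one_add_mul_le_pow (R := ℝ) (a := (2 ^ K)⁻¹) (by have : (0:ℝ) ≤ (2 ^ K)⁻¹ := by positivity
                                                           linarith) (2 ^ K)
  rw [← NNReal.coe_le_coe]
  push_cast at this ⊢
  rw [mul_inv_cancel₀ (by positivity)] at this
  linarith

lemma bet_mono {k k' : ℕ} (h : k ≤ k') : bet k ≤ bet k' := by
  unfold bet
  gcongr
  norm_num

lemma rbound {k k' : ℕ} (h : k ≤ k') :
    ((2 ^ (k + 9) : ℕ) : ℝ≥0) ≤ (1 + (2 ^ (k + 2))⁻¹) ^ bet k' := by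
  refine (bern (k + 2) (k + 9)).trans ?_
  exact pow_le_pow_right₀ (by simp) (bet_mono h)
noncomputable def cc (k : ℕ) : ℝ≥0 := 8 - 4 * (2 ^ k)⁻¹

lemma inv_le_one' (k : ℕ) : ((2 : ℝ≥0) ^ k)⁻¹ ≤ 1 := by
  apply inv_le_one_of_one_le₀
  exact one_le_pow₀ (by norm_num)

lemma cc_add (k : ℕ) : cc k + 4 * (2 ^ k)⁻¹ = 8 := by
  unfold cc
  refine tsub_add_cancel_of_le ?_
  calc 4 * ((2 : ℝ≥0) ^ k)⁻¹ ≤ 4 * 1 := by gcongr; exact inv_le_one' k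
    _ ≤ 8 := by norm_num

lemma cc_le (k : ℕ) : cc k ≤ 8 := tsub_le_self

lemma cc_ge (k : ℕ) : 4 ≤ cc k := by
  have h := cc_add k
  have h2 := inv_le_one' k
  rw [← NNReal.coe_le_coe]
  have h' : (cc k : ℝ) + 4 * (((2 : ℝ≥0) ^ k)⁻¹ : ℝ≥0) = 8 := by exact_mod_cast h
  have h2' : ((((2 : ℝ≥0) ^ k)⁻¹ : ℝ≥0) : ℝ) ≤ 1 := by exact_mod_cast h2
  push_cast at *
  linarith

lemma cc_ge' (k : ℕ) : 6 ≤ cc (k + 1) := by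
  have h := cc_add (k + 1)
  have h2 := inv_le_one' k
  rw [← NNReal.coe_le_coe]
  have h' : (cc (k + 1) : ℝ) + 4 * (((2 : ℝ≥0) ^ (k + 1))⁻¹ : ℝ≥0) = 8 := by exact_mod_cast h
  have h2' : ((((2 : ℝ≥0) ^ k)⁻¹ : ℝ≥0) : ℝ) ≤ 1 := by exact_mod_cast h2
  push_cast at *
  rw [pow_succ, mul_inv] at h'
  linarith

lemma cc_step (k : ℕ) : (1 + (2 ^ (k + 2))⁻¹) * cc k ≤ cc (k + 1) := by
  have h1 := cc_add k
  have h2 := cc_add (k + 1)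
  rw [← NNReal.coe_le_coe]
  have h1' : (cc k : ℝ) + 4 * (((2 : ℝ≥0) ^ k)⁻¹ : ℝ≥0) = 8 := by exact_mod_cast h1
  have h2' : (cc (k + 1) : ℝ) + 4 * (((2 : ℝ≥0) ^ (k + 1))⁻¹ : ℝ≥0) = 8 := by exact_mod_cast h2
  push_cast at *
  rw [pow_succ, mul_inv] at h2'
  rw [pow_add, mul_inv]
  have e1 : (cc k : ℝ) = 8 - 4 * (2 ^ k)⁻¹ := by linarith
  have e2 : (cc (k + 1) : ℝ) = 8 - 4 * ((2 ^ k)⁻¹ * 2⁻¹) := by linarith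
  rw [e1, e2]
  nlinarith [sq_nonneg (((2 : ℝ) ^ k)⁻¹)]

def Y (G : Finset ℕ) (q : TT) : Set TT := {x | ∀ i ∈ G, x i = q i}

/-- The combinatorial core: the sequential construction along cut points. -/
lemma sweep {nm : Finset ℕ → ℕ} {j k : ℕ} {G : Finset ℕ} {q : TT}
    (ih : ((cc (k + 1) : ℝ≥0) : ℝ≥0∞) ≤ phi (Cl nm j (k + 1)) (Y G q))
    (D : Finset ℕ) (nx : ℕ → ℕ) (r : ℝ≥0)
    (hnx : ∀ u ∈ D, ∀ d ∈ D, u < d → nx u ≤ d)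
    (hpred : ∀ d ∈ D, 0 < d → ∃ u ∈ D, u < d ∧ nx u = d ∧ ∀ u' ∈ D, u' < d → u' ≤ u)
    (F1 F2 : Finset El) (asg pk : El → ℕ)
    (hF1 : ∀ e ∈ F1, ∀ z, res (asg e) (nx (asg e)) z r e ∈ Cl nm j (k + 1))
    (hr : ∑ e ∈ F1, r * e.2.2 < cc (k + 1))
    (hpk : ∀ l ∈ F2, ∀ l' ∈ F2, pk l = pk l' → l = l')
    (hw : ∀ l ∈ F2, ∑ e ∈ F1.filter (fun e => asg e = pk l), r * e.2.2 < 1)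
    (hth : ∀ l ∈ F2, ∀ z, 1 ≤ phi (Cl nm j (k + 1)) (Free (pk l) (nx (pk l)) z l.1))
    (hG : ∀ l ∈ F2, ∀ g ∈ G, ¬ (pk l ≤ g ∧ g < nx (pk l))) :
    ∀ d ∈ D, ∃ z : TT, (∀ i ∈ G, i < d → z i = q i) ∧ ∀ u ∈ D, u < d →
      ∀ y : TT, (∀ i, i < nx u → y i = z i) →
        (∀ e ∈ F1, asg e = u → y ∉ e.1) ∧ (∀ l ∈ F2, pk l = u → y ∉ l.1) := by
  intro d
  induction d using Nat.strong_induction_on with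
  | _ d IH =>
  intro hd
  rcases Nat.eq_zero_or_pos d with rfl | hpos
  · exact ⟨q, by simp, by simp⟩
  obtain ⟨u, hu, hud, hnu, humax⟩ := hpred d hd hpos
  obtain ⟨z, hz1, hz2⟩ := IH u hud hu
  -- find x
  have main : ∃ x : TT, (∀ i ∈ G, u ≤ i → i < d → x i = q i) ∧
      (∀ e ∈ F1, asg e = u → x ∈ Free u d z e.1) ∧ (∀ l ∈ F2, pk l = u → x ∈ Free u d z l.1) := by
    have gen : ∀ B : Set TT, ((∑ e ∈ F1.filter (fun e => asg e = u), r * e.2.2 : ℝ≥0) : ℝ≥0∞)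
        < phi (Cl nm j (k + 1)) B → ∃ x ∈ B, ∀ e ∈ F1, asg e = u → x ∈ Free u d z e.1 := by
      intro B hB
      by_contra hcon
      push Not at hcon
      refine absurd (phi_le_fam (Cl nm j (k + 1)) B (F1.filter (fun e => asg e = u))
        (fun e => res u d z r e) ?_ ?_) (not_le.2 hB)
      · intro e he
        rw [Finset.mem_filter] at he
        have := hF1 e he.1 z
        rwa [he.2, hnu] at this
      · intro x hx
        obtain ⟨e, he, h1, h2⟩ := hcon x hx
        exact ⟨e, Finset.mem_filter.2 ⟨he, h1⟩, by simpa [res] using h2⟩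
    by_cases hl : ∃ l ∈ F2, pk l = u
    · obtain ⟨l, hl, hlu⟩ := hl
      obtain ⟨x, hx, hx2⟩ := gen (Free u d z l.1) (by
        have h1 := hw l hl
        have h2 := hth l hl z
        rw [hlu] at h1
        rw [hlu, hnu] at h2
        exact lt_of_lt_of_le (by exact_mod_cast h1) h2)
      refine ⟨x, ?_, hx2, ?_⟩
      · intro i hi h1 h2
        have := hG l hl i hi
        rw [hlu, hnu] at this
        exact absurd ⟨h1, h2⟩ this
      · intro l' hl' h
        rw [hpk l' hl' l hl (h.trans hlu.symm)]
        exact hx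
    · push Not at hl
      obtain ⟨x, hx, hx2⟩ := gen (Y G q) (by
        refine lt_of_lt_of_le ?_ ih
        have : ∑ e ∈ F1.filter (fun e => asg e = u), r * e.2.2 ≤ ∑ e ∈ F1, r * e.2.2 :=
          Finset.sum_le_sum_of_subset (Finset.filter_subset _ _)
        exact_mod_cast lt_of_le_of_lt this hr)
      exact ⟨x, fun i hi _ _ => hx i hi, hx2, fun l h1 h2 => absurd h2 (hl l h1)⟩
  obtain ⟨x, hx1, hx2, hx3⟩ := main
  refine ⟨spl u z x, ?_, ?_⟩
  · intro i hi hid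
    by_cases h : i < u
    · simp [spl, h, hz1 i hi h]
    · simp [spl, h, hx1 i hi (by omega) hid]
  · intro u' hu' hu'd y hy
    rcases Nat.lt_or_ge u' u with h | h
    · refine hz2 u' hu' h y ?_
      intro i hi
      have := hnx u' hu' u hu h
      rw [hy i hi]
      simp [spl, show i < u by omega]
    · have huu : u' = u := le_antisymm (humax u' hu' hu'd) h
      subst huu
      rw [hnu] at hy
      have a1 : ∀ i, i < u' → y i = z i := fun i hi => by rw [hy i (by omega)]; simp [spl, hi]
      have a2 : ∀ i, u' ≤ i → i < d → y i = x i := fun i hi hid => by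
        rw [hy i hid]; simp [spl, not_lt.2 hi]
      exact ⟨fun e he h => hx2 e he h y a1 a2, fun l hl h => hx3 l hl h y a1 a2⟩
noncomputable def nxt (D : Finset ℕ) (u : ℕ) : ℕ := sInf {x | x ∈ D ∧ u < x}

lemma nxt_le {D : Finset ℕ} {u d : ℕ} (hd : d ∈ D) (h : u < d) : nxt D u ≤ d :=
  Nat.sInf_le ⟨hd, h⟩

lemma nxt_mem {D : Finset ℕ} {u d : ℕ} (hd : d ∈ D) (h : u < d) : nxt D u ∈ D ∧ u < nxt D u :=
  Nat.sInf_mem (s := {x | x ∈ D ∧ u < x}) ⟨d, hd, h⟩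

lemma nxt_pred {D : Finset ℕ} (h0 : 0 ∈ D) {d : ℕ} (hd : d ∈ D) (hpos : 0 < d) :
    ∃ u ∈ D, u < d ∧ nxt D u = d ∧ ∀ u' ∈ D, u' < d → u' ≤ u := by
  have hne : (D.filter (fun x => x < d)).Nonempty := ⟨0, by simp [h0, hpos]⟩
  have hm := Finset.max'_mem _ hne
  set u := (D.filter (fun x => x < d)).max' hne with hu
  rw [Finset.mem_filter] at hm
  have hmax : ∀ u' ∈ D, u' < d → u' ≤ u := fun u' h1 h2 =>
    Finset.le_max' _ _ (Finset.mem_filter.2 ⟨h1, h2⟩)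
  refine ⟨u, hm.1, hm.2, ?_, hmax⟩
  refine le_antisymm (nxt_le hd hm.2) ?_
  by_contra hc
  push Not at hc
  have := nxt_mem hd hm.2
  have := hmax _ this.1 hc
  omega

lemma exists_piece {nm : Finset ℕ → ℕ} {GG} (h : NormOK nm GG) {D : Finset ℕ} (h0 : 0 ∈ D) {b : ℕ}
    (hb : b ∈ D) (hb0 : 0 < b) {P : ℕ} (hP : D.card ≤ P) (I : Finset ℕ) (hI : ∀ i ∈ I, i < b) :
    ∃ d ∈ D, d < b ∧ nm I ≤ P * nm (I.filter (fun i => d ≤ i ∧ i < nxt D d)) := by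
  by_contra hc
  push Not at hc
  set D' := D.filter (fun d => d < b) with hD'
  have hD'c : D'.card ≤ P := (Finset.card_le_card (Finset.filter_subset _ _)).trans hP
  have hne : D'.Nonempty := ⟨0, by simp [hD', h0, hb0]⟩
  have h1 : I ⊆ D'.biUnion (fun d => I.filter (fun i => d ≤ i ∧ i < nxt D d)) := by
    intro i hi
    have hib := hI i hi
    have hne : (D.filter (fun x => x ≤ i)).Nonempty := ⟨0, by simp [h0]⟩
    have hm := Finset.max'_mem _ hne
    set u := (D.filter (fun x => x ≤ i)).max' hne with hu
    rw [Finset.mem_filter] at hm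
    have hub : u < b := by omega
    have h2 := nxt_mem hb hub
    rw [Finset.mem_biUnion]
    refine ⟨u, Finset.mem_filter.2 ⟨hm.1, hub⟩, Finset.mem_filter.2 ⟨hi, hm.2, ?_⟩⟩
    by_contra hcon
    push Not at hcon
    have := Finset.le_max' _ _ (Finset.mem_filter.2 ⟨h2.1, hcon⟩ : _ ∈ D.filter (fun x => x ≤ i))
    omega
  have h2 := (h.mono _ _ h1).trans (nm_biUnion h _ _)
  have h3 : P * nm I ≤ ∑ d ∈ D', P * nm (I.filter (fun i => d ≤ i ∧ i < nxt D d)) := by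
    rw [← Finset.mul_sum]; exact Nat.mul_le_mul_left _ h2
  have h4 : ∑ d ∈ D', P * nm (I.filter (fun i => d ≤ i ∧ i < nxt D d)) < ∑ _d ∈ D', nm I :=
    Finset.sum_lt_sum_of_nonempty hne (fun d hd => hc d (Finset.mem_filter.1 hd).1 (Finset.mem_filter.1 hd).2)
  rw [Finset.sum_const, _root_.smul_eq_mul] at h4
  have := Nat.mul_le_mul_right (nm I) hD'c
  omega

lemma exists_light (F1 : Finset El) (asg : El → ℕ) (U : Finset (ℕ × ℕ)) (hU : U.card = 16)
    (hlt : ∀ p ∈ U, p.1 < p.2) (hdj : ∀ p ∈ U, ∀ q ∈ U, p ≠ q → Dj p q)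
    (hs : ∑ e ∈ F1, e.2.2 < 8) :
    ∃ p ∈ U, ∑ e ∈ F1.filter (fun e => asg e = p.1), e.2.2 ≤ 1 / 2 := by
  by_contra hc
  push Not at hc
  have hne : U.Nonempty := by rw [← Finset.card_pos]; omega
  have h1 : ∑ _p ∈ U, (1 / 2 : ℝ≥0) < ∑ p ∈ U, ∑ e ∈ F1.filter (fun e => asg e = p.1), e.2.2 :=
    Finset.sum_lt_sum_of_nonempty hne hc
  rw [← Finset.sum_biUnion] at h1
  · have h2 : ∑ e ∈ U.biUnion (fun p => F1.filter (fun e => asg e = p.1)), e.2.2 ≤ ∑ e ∈ F1, e.2.2 := by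
      apply Finset.sum_le_sum_of_subset
      intro e he
      obtain ⟨p, _, h⟩ := Finset.mem_biUnion.1 he
      exact (Finset.mem_filter.1 h).1
    rw [Finset.sum_const, hU] at h1
    have h3 : (16 • (1 / 2 : ℝ≥0)) = 8 := by norm_num
    rw [h3] at h1
    exact absurd (h1.trans_le h2) (not_lt.2 hs.le)
  · intro p hp q hq hpq
    rw [Function.onFun, Finset.disjoint_left]
    intro e he he'
    have a := (Finset.mem_filter.1 he).2
    have b := (Finset.mem_filter.1 he').2
    have := hdj p hp q hq hpq
    have := hlt p hp
    have := hlt q hq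
    unfold Dj at *
    omega

theorem claim {nm : Finset ℕ → ℕ} {GG : Set (Finset ℕ)} (h : NormOK nm GG) :
    ∀ (j k : ℕ) (G : Finset ℕ), G ∈ GG → ∀ q : TT, ((cc k : ℝ≥0) : ℝ≥0∞) ≤ phi (Cl nm j k) (Y G q) := by
  intro j
  induction j with
  | zero =>
    intro k G _ q
    refine le_iInf fun F => le_iInf fun h1 => le_iInf fun h2 => ?_
    obtain ⟨e, he, _⟩ := h2 q (fun i _ => rfl)
    exact absurd (h1 e he) (by simp [Cl])
  | succ j ih =>
    intro k G hGG q
    by_contra hcon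
    obtain ⟨F, hF, hcov, hsum⟩ := exists_of_phi_lt (not_le.1 hcon)
    have hsum : ∑ e ∈ F, e.2.2 < cc k := by exact_mod_cast hsum
    have hsum8 : ∑ e ∈ F, e.2.2 < 8 := hsum.trans_le (cc_le k)
    set F1 := F.filter (fun e => e ∈ Cl nm j (k + 1)) with hF1
    set F2 := F.filter (fun e => ¬ e ∈ Cl nm j (k + 1)) with hF2
    have hF1s : ∑ e ∈ F1, e.2.2 ≤ ∑ e ∈ F, e.2.2 := Finset.sum_le_sum_of_subset (Finset.filter_subset _ _)
    have hF2E : ∀ l ∈ F2, l ∈ Ek nm k (phi (Cl nm j (k + 1))) := by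
      intro l hl
      rw [Finset.mem_filter] at hl
      exact (hF l hl.1).resolve_left hl.2
    have hwl : ∀ l ∈ F2, l.2.2 ≤ 8 := fun l hl =>
      (Finset.single_le_sum (f := fun e : El => e.2.2) (fun _ _ => zero_le) (Finset.mem_filter.1 hl).1).trans hsum8.le
    have hcard : F2.card ≤ 8 * 2 ^ k := by
      have h1 : ∑ _l ∈ F2, (1 : ℝ≥0) ≤ ∑ l ∈ F2, 2 ^ k * l.2.2 :=
        Finset.sum_le_sum fun l hl => (hF2E l hl).1
      rw [← Finset.mul_sum] at h1
      have h2 : ∑ e ∈ F2, e.2.2 ≤ ∑ e ∈ F, e.2.2 := Finset.sum_le_sum_of_subset (Finset.filter_subset _ _)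
      have h3 : (F2.card : ℝ≥0) ≤ 2 ^ k * 8 := by
        calc (F2.card : ℝ≥0) = ∑ _l ∈ F2, (1 : ℝ≥0) := by simp
          _ ≤ _ := h1
          _ ≤ 2 ^ k * 8 := by gcongr; exact h2.trans hsum8.le
      have : F2.card ≤ 2 ^ k * 8 := by exact_mod_cast h3
      omega
    have hnm : ∀ l ∈ F2, 128 * 2 ^ k + 2 ≤ nm l.2.1 := by
      intro l hl
      have h1 := (hF2E l hl).2.1
      have h2 : (nm l.2.1 : ℝ≥0) * (2 ^ k * l.2.2) ^ bet k ≤ (nm l.2.1 : ℝ≥0) * (2 ^ k * 8) ^ bet k := by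
        gcongr; exact hwl l hl
      have h3 := h1.trans h2
      have h4 : NN k ≤ nm l.2.1 * (2 ^ k * 8) ^ bet k := by exact_mod_cast h3
      unfold NN at h4
      rw [mul_comm] at h4
      exact Nat.le_of_mul_le_mul_right h4 (by positivity)
    obtain ⟨U, hU1, hU2, hU3⟩ := select 16 F2.card F2 rfl (fun l => gd G l.2.1)
      (fun l hl => by have := hnm l hl; have := h.good G hGG l.2.1; omega)
      (fun l hl p hp => (gd_spec hp).2.2.1) (fun l hl p hp q hq hpq => gd_dj hp hq hpq)
    set b := (F.biUnion (fun e => e.2.1)).sup id + 1 with hb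
    have hbI : ∀ e ∈ F, ∀ i ∈ e.2.1, i < b := by
      intro e he i hi
      have : i ≤ (F.biUnion (fun e => e.2.1)).sup id :=
        Finset.le_sup (f := id) (Finset.mem_biUnion.2 ⟨e, he, hi⟩)
      omega
    set D := insert 0 (insert b (F2.biUnion (fun l => (U l).image Prod.fst ∪ (U l).image Prod.snd))) with hD
    have h0D : 0 ∈ D := by simp [hD]
    have hbD : b ∈ D := by simp [hD]
    have hUI : ∀ l ∈ F2, ∀ p ∈ U l, p.1 < p.2 ∧ p.2 < b ∧ p.1 ∈ l.2.1 ∧ p.2 ∈ l.2.1 ∧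
        ∀ g ∈ G, ¬ (p.1 ≤ g ∧ g < p.2) := by
      intro l hl p hp
      have := gd_spec (hU1 l hl hp)
      exact ⟨this.2.2.1, hbI l (Finset.mem_filter.1 hl).1 _ this.2.1, this.1, this.2.1, this.2.2.2⟩
    have hD1 : ∀ l ∈ F2, ∀ p ∈ U l, p.1 ∈ D ∧ p.2 ∈ D := by
      intro l hl p hp
      constructor
      · refine Finset.mem_insert_of_mem (Finset.mem_insert_of_mem (Finset.mem_biUnion.2 ⟨l, hl, ?_⟩))
        exact Finset.mem_union_left _ (Finset.mem_image_of_mem _ hp)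
      · refine Finset.mem_insert_of_mem (Finset.mem_insert_of_mem (Finset.mem_biUnion.2 ⟨l, hl, ?_⟩))
        exact Finset.mem_union_right _ (Finset.mem_image_of_mem _ hp)
    have hDc : D.card ≤ 2 ^ (k + 9) := by
      have h1 : (F2.biUnion (fun l => (U l).image Prod.fst ∪ (U l).image Prod.snd)).card ≤ F2.card * 32 := by
        apply Finset.card_biUnion_le_card_mul
        intro l hl
        refine (Finset.card_union_le _ _).trans ?_
        have a1 := Finset.card_image_le (s := U l) (f := Prod.fst)
        have a2 := Finset.card_image_le (s := U l) (f := Prod.snd)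
        have := hU2 l hl
        omega
      have h2 : D.card ≤ (insert b (F2.biUnion (fun l => (U l).image Prod.fst ∪ (U l).image Prod.snd))).card + 1 := Finset.card_insert_le _ _
      have h3 : (insert b (F2.biUnion (fun l => (U l).image Prod.fst ∪ (U l).image Prod.snd))).card ≤ (F2.biUnion (fun l => (U l).image Prod.fst ∪ (U l).image Prod.snd)).card + 1 := Finset.card_insert_le b (F2.biUnion (fun l => (U l).image Prod.fst ∪ (U l).image Prod.snd))
      have h4 : 2 ^ (k + 9) = 512 * 2 ^ k := by rw [pow_add]; ring
      have h5 : 1 ≤ 2 ^ k := Nat.one_le_two_pow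
      rw [h4]
      omega
    have hnx : ∀ l ∈ F2, ∀ p ∈ U l, nxt D p.1 = p.2 := by
      intro l hl p hp
      have hlt := (hUI l hl p hp).1
      have h1 := nxt_le (hD1 l hl p hp).2 hlt
      have h2 := nxt_mem (hD1 l hl p hp).2 hlt
      refine le_antisymm h1 ?_
      rcases Finset.mem_insert.1 h2.1 with h3 | h3
      · omega
      rcases Finset.mem_insert.1 h3 with h4 | h4
      · have := (hUI l hl p hp).2.1; omega
      obtain ⟨l', hl', h5⟩ := Finset.mem_biUnion.1 h4
      have : ∃ p' ∈ U l', nxt D p.1 = p'.1 ∨ nxt D p.1 = p'.2 := by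
        rcases Finset.mem_union.1 h5 with h6 | h6
        · obtain ⟨p', a, b⟩ := Finset.mem_image.1 h6
          exact ⟨p', a, Or.inl b.symm⟩
        · obtain ⟨p', a, b⟩ := Finset.mem_image.1 h6
          exact ⟨p', a, Or.inr b.symm⟩
      obtain ⟨p', hp', h7⟩ := this
      have hlt' := (hUI l' hl' p' hp').1
      by_cases heq : l = l' ∧ p = p'
      · rw [← heq.2] at h7; omega
      · have := hU3 l hl l' hl' p hp p' hp' (by tauto)
        unfold Dj at this
        omega
    set r : ℝ≥0 := 1 + (2 ^ (k + 2))⁻¹ with hr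
    have hr1 : 1 ≤ r := by rw [hr]; exact le_self_add
    have hr54 : r ≤ 5 / 4 := by
      have : ((2 : ℝ≥0) ^ (k + 2))⁻¹ = (2 ^ k)⁻¹ * 4⁻¹ := by rw [pow_add, mul_inv]; norm_num
      rw [hr, this]
      calc (1 : ℝ≥0) + (2 ^ k)⁻¹ * 4⁻¹ ≤ 1 + 1 * 4⁻¹ := by gcongr; exact inv_le_one' k
        _ = 5 / 4 := by norm_num
    have hasg : ∀ e : El, ∃ d, e ∈ F1 → (d ∈ D ∧ d < b ∧
        nm e.2.1 ≤ 2 ^ (k + 9) * nm (e.2.1.filter (fun i => d ≤ i ∧ i < nxt D d))) := by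
      intro e
      by_cases he : e ∈ F1
      · obtain ⟨d, h1, h2, h3⟩ := exists_piece h h0D hbD (by omega) hDc e.2.1
          (hbI e (Finset.mem_filter.1 he).1)
        exact ⟨d, fun _ => ⟨h1, h2, h3⟩⟩
      · exact ⟨0, fun h => absurd h he⟩
    choose asg hasg using hasg
    have hpk : ∀ l : El, ∃ p : ℕ × ℕ, l ∈ F2 → (p ∈ U l ∧
        ∑ e ∈ F1.filter (fun e => asg e = p.1), e.2.2 ≤ 1 / 2) := by
      intro l
      by_cases hl : l ∈ F2
      · obtain ⟨p, h1, h2⟩ := exists_light F1 asg (U l) (hU2 l hl) (fun p hp => (hUI l hl p hp).1)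
          (fun p hp q hq hpq => hU3 l hl l hl p hp q hq (Or.inr hpq)) (hF1s.trans_lt hsum8)
        exact ⟨p, fun _ => ⟨h1, h2⟩⟩
      · exact ⟨(0, 0), fun h => absurd h hl⟩
    choose pk hpk using hpk
    obtain ⟨z, hz1, hz2⟩ := sweep (ih (k + 1) G hGG q) D (nxt D) r
      (fun u hu d hd hud => nxt_le hd hud) (fun d hd hpos => nxt_pred h0D hd hpos)
      F1 F2 asg (fun l => (pk l).1)
      (fun e he z => res_mem nm _ _ z r hr1 (2 ^ (k + 9)) j (k + 1)
        (fun k' hk' => rbound (by omega)) e (Finset.mem_filter.1 he).2 (hasg e he).2.2)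
      (by
        rw [← Finset.mul_sum]
        refine lt_of_lt_of_le ?_ (cc_step k)
        exact mul_lt_mul_of_pos_left (hF1s.trans_lt hsum) (by positivity))
      (by
        intro l hl l' hl' heq
        by_contra hne
        have a := hU3 l hl l' hl' _ (hpk l hl).1 _ (hpk l' hl').1 (Or.inl hne)
        have b1 := (hUI l hl _ (hpk l hl).1).1
        have b2 := (hUI l' hl' _ (hpk l' hl').1).1
        unfold Dj at a
        omega)
      (by
        intro l hl
        rw [← Finset.mul_sum]
        calc r * ∑ e ∈ F1.filter (fun e => asg e = (pk l).1), e.2.2 ≤ 5 / 4 * (1 / 2) := by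
              gcongr; exact (hpk l hl).2
          _ < 1 := by rw [← NNReal.coe_lt_coe]; push_cast; norm_num)
      (by
        intro l hl z
        have a := hUI l hl _ (hpk l hl).1
        rw [hnx l hl _ (hpk l hl).1]
        exact (hF2E l hl).2.2 _ a.2.2.1 _ a.2.2.2.1 a.1 z)
      (by
        intro l hl g hg
        rw [hnx l hl _ (hpk l hl).1]
        exact (hUI l hl _ (hpk l hl).1).2.2.2.2 g hg)
      b hbD
    obtain ⟨e, he, hex⟩ := hcov (spl b z q) (by
      intro i hi
      by_cases hib : i < b
      · simp [spl, hib, hz1 i hi hib]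
      · simp [spl, hib])
    have key : ∀ u ∈ D, u < b → ∀ i, i < nxt D u → spl b z q i = z i := by
      intro u hu hub i hi
      have := nxt_le hbD hub
      simp [spl, show i < b by omega]
    by_cases he1 : e ∈ Cl nm j (k + 1)
    · have heF : e ∈ F1 := Finset.mem_filter.2 ⟨he, he1⟩
      have a := hasg e heF
      exact (hz2 _ a.1 a.2.1 _ (key _ a.1 a.2.1)).1 e heF rfl hex
    · have heF : e ∈ F2 := Finset.mem_filter.2 ⟨he, he1⟩
      have a := hUI e heF _ (hpk e heF).1
      have a1 := (hD1 e heF _ (hpk e heF).1).1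
      have a2 : (pk e).1 < b := a.1.trans a.2.1
      exact (hz2 _ a1 a2 _ (key _ a1 a2)).2 e heF rfl hex
noncomputable abbrev UU : Ultrafilter ℕ := hyperfilter ℕ

noncomputable def mu (nm : Finset ℕ → ℕ) (k p : ℕ) (B : Set TT) : ℝ≥0∞ := phi (Cl nm (p - k) k) B

noncomputable def nu (nm : Finset ℕ → ℕ) (k : ℕ) (B : Set TT) : ℝ≥0∞ :=
  limsup (fun p => mu nm k p B) (UU : Filter ℕ)

section nuBasic
variable {nm : Finset ℕ → ℕ} {k : ℕ}

lemma ev_ge (N : ℕ) : ∀ᶠ p in (UU : Filter ℕ), N ≤ p := by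
  have : (UU : Filter ℕ) ≤ atTop := by
    rw [← Nat.cofinite_eq_atTop]; exact hyperfilter_le_cofinite
  exact this (eventually_ge_atTop N)

lemma nu_le {B : Set TT} {c : ℝ≥0∞} (h : ∀ᶠ p in (UU : Filter ℕ), mu nm k p B ≤ c) : nu nm k B ≤ c :=
  limsup_le_of_le (by isBoundedDefault) h

lemma ev_lt {B : Set TT} {c : ℝ≥0∞} (h : nu nm k B < c) : ∀ᶠ p in (UU : Filter ℕ), mu nm k p B < c :=
  eventually_lt_of_limsup_lt h

lemma ev_gt {B : Set TT} {c : ℝ≥0∞} (h : c < nu nm k B) : ∀ᶠ p in (UU : Filter ℕ), c < mu nm k p B :=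
  Ultrafilter.frequently_iff_eventually.1 (frequently_lt_of_lt_limsup (by isBoundedDefault) h)

lemma le_nu {B : Set TT} {c : ℝ≥0∞} (h : ∀ᶠ p in (UU : Filter ℕ), c ≤ mu nm k p B) : c ≤ nu nm k B :=
  le_limsup_of_frequently_le h.frequently (by isBoundedDefault)

lemma nu_empty : nu nm k ∅ = 0 := by
  have : nu nm k ∅ ≤ 0 := nu_le (Eventually.of_forall fun p => (phi_empty _).le)
  simpa using this

lemma nu_mono {A B : Set TT} (h : A ⊆ B) : nu nm k A ≤ nu nm k B :=
  limsup_le_limsup (Eventually.of_forall fun p => phi_mono _ h)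

lemma nu_union (A B : Set TT) : nu nm k (A ∪ B) ≤ nu nm k A + nu nm k B := by
  refine le_of_forall_gt fun c hc => ?_
  obtain ⟨a, ha, b, hb, h⟩ := ENNReal.exists_add_lt_of_add_lt hc
  refine lt_of_le_of_lt (nu_le ?_) h
  filter_upwards [ev_lt ha, ev_lt hb] with p h1 h2
  exact (phi_union _ A B).trans (add_le_add h1.le h2.le)

lemma nu_biUnion {ι : Type*} (s : Finset ι) (A : ι → Set TT) :
    nu nm k (⋃ i ∈ s, A i) ≤ ∑ i ∈ s, nu nm k (A i) := by
  induction s using Finset.induction_on with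
  | empty => simp [nu_empty]
  | insert a s ha ih =>
    rw [Finset.set_biUnion_insert, Finset.sum_insert ha]
    exact (nu_union _ _).trans (add_le_add le_rfl ih)

lemma nu_succ (B : Set TT) : nu nm k B ≤ nu nm (k + 1) B := by
  refine limsup_le_limsup ?_
  filter_upwards [ev_ge (k + 1)] with p hp
  unfold mu
  obtain ⟨j, hj⟩ : ∃ j, p = k + 1 + j := ⟨p - (k + 1), by omega⟩
  have h1 : p - k = j + 1 := by omega
  have h2 : p - (k + 1) = j := by omega
  rw [h1, h2]
  exact phi_anti (fun e he => Or.inl he) B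

lemma nu_zero_le (B : Set TT) (k : ℕ) : nu nm 0 B ≤ nu nm k B := by
  induction k with
  | zero => exact le_rfl
  | succ k ih => exact ih.trans (nu_succ B)

lemma nu_claim {GG} (h : NormOK nm GG) {G} (hG : G ∈ GG) (q : TT) (k : ℕ) :
    ((cc k : ℝ≥0) : ℝ≥0∞) ≤ nu nm k (Y G q) :=
  le_nu (Eventually.of_forall fun _ => claim h _ k G hG q)

lemma nu_univ {GG} (h : NormOK nm GG) (k : ℕ) :
    ((cc k : ℝ≥0) : ℝ≥0∞) ≤ nu nm k Set.univ :=
  (nu_claim h h.emp (fun _ => 0) k).trans (nu_mono (Set.subset_univ _))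

end nuBasic

def Dep (n : ℕ) (C : Set TT) : Prop := ∀ x y : TT, (∀ i, i < n → x i = y i) → x ∈ C → y ∈ C

def Inv (m : ℕ) (C : Set TT) : Prop := ∀ x y : TT, (∀ i, m ≤ i → x i = y i) → x ∈ C → y ∈ C

def tr (m : ℕ) (z : TT) : TT := spl m z (fun _ => 0)

lemma Dep.mono {n n' : ℕ} {C : Set TT} (h : Dep n C) (hn : n ≤ n') : Dep n' C :=
  fun x y hxy hx => h x y (fun i hi => hxy i (by omega)) hx

lemma Dep.compl {n : ℕ} {C : Set TT} (h : Dep n C) : Dep n Cᶜ :=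
  fun x y hxy hx hy => hx (h y x (fun i hi => (hxy i hi).symm) hy)

lemma Inv.compl {n : ℕ} {C : Set TT} (h : Inv n C) : Inv n Cᶜ :=
  fun x y hxy hx hy => hx (h y x (fun i hi => (hxy i hi).symm) hy)

lemma tr_eq {m : ℕ} {z z' : TT} (h : ∀ i, i < m → z i = z' i) : tr m z = tr m z' := by
  funext i
  by_cases hi : i < m
  · simp [tr, spl, hi, h i hi]
  · simp [tr, spl, hi]

lemma finite_tr (m : ℕ) : (Set.range (tr m)).Finite := by
  have : Set.range (tr m) ⊆ Set.range (fun (f : (i : Fin m) → Fin (2 ^ (i : ℕ))) =>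
      (fun i => if h : i < m then f ⟨i, h⟩ else 0 : TT)) := by
    rintro _ ⟨z, rfl⟩
    refine ⟨fun i => z i, ?_⟩
    funext i
    by_cases h : i < m <;> simp [tr, spl, h]
  exact (Set.finite_range _).subset this

lemma finite_Dep (n : ℕ) : {C : Set TT | Dep n C}.Finite := by
  have : {C : Set TT | Dep n C} ⊆ (fun D : Set TT => (tr n) ⁻¹' D) '' (Set.range (tr n)).powerset := by
    intro C hC
    refine ⟨C ∩ Set.range (tr n), Set.inter_subset_right, ?_⟩
    ext x
    have a : ∀ i, i < n → x i = tr n x i := fun i hi => by simp [tr, spl, hi]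
    constructor
    · intro hx
      exact hC _ _ (fun i hi => (a i hi).symm) hx.1
    · intro hx
      exact ⟨hC _ _ a hx, x, rfl⟩
  exact ((finite_tr n).powerset.image _).subset this

lemma r54 (k : ℕ) : ((2 : ℕ) : ℝ≥0) ≤ (5 / 4 : ℝ≥0) ^ bet k := by
  have h1 := bern 2 1
  have h2 : (1 + (2 ^ 2)⁻¹ : ℝ≥0) = 5 / 4 := by norm_num
  rw [h2] at h1
  have h3 : 2 ^ 2 * 1 ≤ bet k := by
    unfold bet
    have : 1 ≤ 2 ^ k := Nat.one_le_two_pow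
    rw [pow_add]
    nlinarith
  have h4 : (1 : ℝ≥0) ≤ 5 / 4 := by rw [← NNReal.coe_le_coe]; push_cast; norm_num
  calc ((2 : ℕ) : ℝ≥0) = ((2 ^ 1 : ℕ) : ℝ≥0) := by norm_num
    _ ≤ _ := h1
    _ ≤ _ := pow_le_pow_right₀ h4 h3

lemma one54 : (1 : ℝ≥0) ≤ 5 / 4 := by rw [← NNReal.coe_le_coe]; push_cast; norm_num

/-- A small family does not cover. -/
lemma avoid {nm : Finset ℕ → ℕ} {GG} (h : NormOK nm GG) {j k : ℕ} (F : Finset El) (g : El → El)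
    (hF : ∀ e ∈ F, g e ∈ Cl nm j k) (hs : ∑ e ∈ F, (g e).2.2 < 4) : ∃ y, ∀ e ∈ F, y ∉ (g e).1 := by
  by_contra hc
  push Not at hc
  have h1 := phi_le_fam (Cl nm j k) (Y ∅ (fun _ => 0)) F g hF (fun x _ => hc x)
  have h2 := (claim h j k ∅ h.emp (fun _ => 0)).trans h1
  have h3 : cc k ≤ ∑ e ∈ F, (g e).2.2 := by exact_mod_cast h2
  exact absurd ((cc_ge k).trans h3) (not_le.2 hs)

def Nr (nm : Finset ℕ → ℕ) (n : ℕ) (e : El) : Prop :=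
  nm e.2.1 ≤ 2 * nm (e.2.1.filter (fun i => 0 ≤ i ∧ i < n))

lemma Nr.mono {nm : Finset ℕ → ℕ} {GG} (h : NormOK nm GG) {n n' : ℕ} (hn : n ≤ n') {e : El}
    (he : Nr nm n e) : Nr nm n' e := by
  unfold Nr at *
  have := h.mono (e.2.1.filter (fun i => 0 ≤ i ∧ i < n)) (e.2.1.filter (fun i => 0 ≤ i ∧ i < n'))
    (by intro i hi; rw [Finset.mem_filter] at *; exact ⟨hi.1, hi.2.1, by omega⟩)
  omega

lemma not_Nr {nm : Finset ℕ → ℕ} {GG} (h : NormOK nm GG) {n b : ℕ} {e : El}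
    (hb : ∀ i ∈ e.2.1, i < b) (he : ¬ Nr nm n e) :
    nm e.2.1 ≤ 2 * nm (e.2.1.filter (fun i => n ≤ i ∧ i < b)) := by
  unfold Nr at *
  have h1 := h.sub (e.2.1.filter (fun i => 0 ≤ i ∧ i < n)) (e.2.1.filter (fun i => n ≤ i ∧ i < b))
  have h2 := h.mono e.2.1 (e.2.1.filter (fun i => 0 ≤ i ∧ i < n) ∪ e.2.1.filter (fun i => n ≤ i ∧ i < b))
    (by
      intro i hi
      rw [Finset.mem_union, Finset.mem_filter, Finset.mem_filter]
      have := hb i hi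
      by_cases hin : i < n
      · exact Or.inl ⟨hi, by omega, hin⟩
      · exact Or.inr ⟨hi, by omega, this⟩)
  omega

lemma exists_bd (F : Finset El) : ∃ b : ℕ, ∀ e ∈ F, ∀ i ∈ e.2.1, i < b := by
  refine ⟨(F.biUnion (fun e => e.2.1)).sup id + 1, ?_⟩
  intro e he i hi
  have : i ≤ (F.biUnion (fun e => e.2.1)).sup id :=
    Finset.le_sup (f := id) (Finset.mem_biUnion.2 ⟨e, he, hi⟩)
  omega

lemma sum54 (F F' : Finset El) (hF' : F' ⊆ F) (hs : ∑ e ∈ F, e.2.2 ≤ 2) (f : El → El)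
    (hf : ∀ e, (f e).2.2 = 5 / 4 * e.2.2) : ∑ e ∈ F', (f e).2.2 < 4 := by
  have h1 : ∑ e ∈ F', e.2.2 ≤ ∑ e ∈ F, e.2.2 := Finset.sum_le_sum_of_subset hF'
  simp only [hf]
  rw [← Finset.mul_sum]
  calc 5 / 4 * ∑ e ∈ F', e.2.2 ≤ 5 / 4 * 2 := by gcongr; exact h1.trans hs
    _ < 4 := by rw [← NNReal.coe_lt_coe]; push_cast; norm_num

lemma tail_avoid {nm : Finset ℕ → ℕ} {GG} (h : NormOK nm GG) {j k : ℕ} (F : Finset El)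
    (hF : ∀ e ∈ F, e ∈ Cl nm j k) (hs : ∑ e ∈ F, e.2.2 ≤ 2) (n : ℕ) (x : TT) :
    ∃ y, ∀ e ∈ F, ¬ Nr nm n e → spl n x y ∉ e.1 := by
  obtain ⟨b, hb⟩ := exists_bd F
  obtain ⟨y, hy⟩ := avoid h (j := j) (k := k) (F.filter (fun e => ¬ Nr nm n e)) (res n b x (5 / 4))
    (by
      intro e he
      rw [Finset.mem_filter] at he
      exact res_mem nm n b x _ one54 2 j k (fun k' _ => r54 k') e (hF e he.1)
        (not_Nr h (hb e he.1) he.2))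
    (sum54 F _ (Finset.filter_subset _ _) hs _ (fun e => rfl))
  refine ⟨y, fun e he hne => ?_⟩
  have := mem_res.1 (hy e (Finset.mem_filter.2 ⟨he, hne⟩))
  refine this _ (fun i hi => by simp [spl, hi]) (fun i hi _ => by simp [spl, show ¬ i < n by omega])

lemma head_mem {nm : Finset ℕ → ℕ} {j k : ℕ} {e : El} (he : e ∈ Cl nm j k) {n : ℕ} (hn : Nr nm n e) (x : TT) :
    res 0 n x (5 / 4) e ∈ Cl nm j k :=
  res_mem nm 0 n x _ one54 2 j k (fun k' _ => r54 k') e he hn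

lemma head_avoid {nm : Finset ℕ → ℕ} {GG} (h : NormOK nm GG) {j k : ℕ} (F : Finset El)
    (hF : ∀ e ∈ F, e ∈ Cl nm j k) (hs : ∑ e ∈ F, e.2.2 ≤ 2) (n : ℕ) :
    ∃ u : TT, ∀ e ∈ F, Nr nm n e → ∀ y, spl n u y ∉ e.1 := by
  obtain ⟨y, hy⟩ := avoid h (j := j) (k := k) (F.filter (fun e => Nr nm n e)) (res 0 n (fun _ => 0) (5 / 4))
    (by
      intro e he
      rw [Finset.mem_filter] at he
      exact head_mem (hF e he.1) he.2 _)
    (sum54 F _ (Finset.filter_subset _ _) hs _ (fun e => rfl))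
  refine ⟨y, fun e he hne y' => ?_⟩
  have := mem_res.1 (hy e (Finset.mem_filter.2 ⟨he, hne⟩))
  refine this _ (fun i hi => by omega) (fun i _ hi => by simp [spl, hi])

lemma Free_inv {m n : ℕ} {X : Set TT} (u : TT) : Inv m (Free m n u X)ᶜ := by
  apply Inv.compl
  intro x y hxy hx y' h1 h2
  exact hx y' h1 (fun i hi hin => by rw [h2 i hi hin, hxy i hi])

lemma cov {nm : Finset ℕ → ℕ} {GG} (h : NormOK nm GG) {j k m : ℕ} {E : Set TT} (hE : Inv m E)
    (hlt : phi (Cl nm j k) E < ((3 / 2 : ℝ≥0) : ℝ≥0∞)) :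
    ∃ F : Finset El, (∀ e ∈ F, e ∈ Cl nm j k ∧ Inv m e.1) ∧ (∀ x ∈ E, ∃ e ∈ F, x ∈ e.1) ∧
      ∑ e ∈ F, e.2.2 ≤ 15 / 8 := by
  obtain ⟨F, hF, hcov, hsum⟩ := exists_of_phi_lt hlt
  have hsum : ∑ e ∈ F, e.2.2 < 3 / 2 := by exact_mod_cast hsum
  have hs2 : ∑ e ∈ F, e.2.2 ≤ 2 := hsum.le.trans (by rw [← NNReal.coe_le_coe]; push_cast; norm_num)
  obtain ⟨u, hu⟩ := head_avoid h F hF hs2 m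
  obtain ⟨b, hb⟩ := exists_bd F
  refine ⟨(F.filter (fun e => ¬ Nr nm m e)).image (res m b u (5 / 4)), ?_, ?_, ?_⟩
  · intro e he
    obtain ⟨e, he', rfl⟩ := Finset.mem_image.1 he
    rw [Finset.mem_filter] at he'
    exact ⟨res_mem nm m b u _ one54 2 j k (fun k' _ => r54 k') e (hF e he'.1)
        (not_Nr h (hb e he'.1) he'.2), Free_inv u⟩
  · intro x hx
    obtain ⟨e, he, hex⟩ := hcov (spl m u x) (hE x _ (fun i hi => by simp [spl, show ¬ i < m by omega]) hx)
    have hn : ¬ Nr nm m e := fun hn => hu e he hn x hex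
    refine ⟨_, Finset.mem_image_of_mem _ (Finset.mem_filter.2 ⟨he, hn⟩), ?_⟩
    by_contra hc
    exact mem_res.1 hc _ (fun i hi => by simp [spl, hi]) (fun i hi _ => by simp [spl, show ¬ i < m by omega]) hex
  · refine (Finset.sum_image_le_of_nonneg (fun _ _ => zero_le)).trans ?_
    simp only [res]
    rw [← Finset.mul_sum]
    calc 5 / 4 * ∑ e ∈ F.filter (fun e => ¬ Nr nm m e), e.2.2 ≤ 5 / 4 * (3 / 2) := by
          gcongr; exact (Finset.sum_le_sum_of_subset (Finset.filter_subset _ _)).trans hsum.le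
      _ ≤ 15 / 8 := by rw [← NNReal.coe_le_coe]; push_cast; norm_num
lemma fam {nm : Finset ℕ → ℕ} {GG} (h : NormOK nm GG) {k m : ℕ} {E : ℕ → Set TT} (hE : ∀ i, Inv m (E i))
    (hle : ∀ r, nu nm k (⋃ i ∈ Finset.range r, E i) ≤ 1) :
    ∃ F : ℕ → Finset El, (∀ p, ∀ e ∈ F p, e ∈ Cl nm (p - k) k ∧ Inv m e.1) ∧
      (∀ p, ∑ e ∈ F p, e.2.2 ≤ 15 / 8) ∧
      ∀ i, ∀ᶠ p in (UU : Filter ℕ), ∀ x ∈ E i, ∃ e ∈ F p, x ∈ e.1 := by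
  have key : ∀ p : ℕ, ∃ F : Finset El, (∀ e ∈ F, e ∈ Cl nm (p - k) k ∧ Inv m e.1) ∧
      (∑ e ∈ F, e.2.2 ≤ 15 / 8) ∧
      ∀ r ≤ p, mu nm k p (⋃ i ∈ Finset.range r, E i) < ((3 / 2 : ℝ≥0) : ℝ≥0∞) →
        ∀ x ∈ (⋃ i ∈ Finset.range r, E i), ∃ e ∈ F, x ∈ e.1 := by
    intro p
    set P : ℕ → Prop := fun r => mu nm k p (⋃ i ∈ Finset.range r, E i) < ((3 / 2 : ℝ≥0) : ℝ≥0∞) with hP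
    have h0 : P 0 := by
      simp only [hP, Finset.range_zero, Finset.notMem_empty, Set.iUnion_of_empty, Set.iUnion_empty, mu, phi_empty]
      norm_num
    have h1 : P (Nat.findGreatest P p) := Nat.findGreatest_spec (Nat.zero_le p) h0
    obtain ⟨F, a, b, c⟩ := cov h (j := p - k) (k := k) (m := m) (E := ⋃ i ∈ Finset.range (Nat.findGreatest P p), E i)
      (by
        intro x y hxy hx
        simp only [Set.mem_iUnion] at hx ⊢
        obtain ⟨i, hi, hx⟩ := hx
        exact ⟨i, hi, hE i x y hxy hx⟩) h1
    refine ⟨F, a, c, fun r hr hr2 x hx => b x ?_⟩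
    have h2 : r ≤ Nat.findGreatest P p := Nat.le_findGreatest hr hr2
    simp only [Set.mem_iUnion, Finset.mem_range] at hx ⊢
    obtain ⟨i, hi, hx⟩ := hx
    exact ⟨i, by omega, hx⟩
  choose F h1 h2 h3 using key
  refine ⟨F, h1, h2, fun i => ?_⟩
  have h4 : nu nm k (⋃ j ∈ Finset.range (i + 1), E j) < ((3 / 2 : ℝ≥0) : ℝ≥0∞) := by
    refine (hle _).trans_lt ?_
    rw [← ENNReal.coe_one, ENNReal.coe_lt_coe, ← NNReal.coe_lt_coe]; push_cast; norm_num
  filter_upwards [ev_lt h4, ev_ge (i + 1)] with p hp hp2 x hx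
  refine h3 p (i + 1) hp2 hp x ?_
  simp only [Set.mem_iUnion, Finset.mem_range]
  exact ⟨i, by omega, hx⟩

lemma stab (v : ℕ → ℕ → ℝ≥0) (hv : ∀ n p, v n p ≤ 2) (hm : ∀ n n' p, n ≤ n' → v n p ≤ v n' p)
    (δ : ℝ≥0) (hδ : 0 < δ) :
    ∃ n0, ∀ n, n0 ≤ n → ∀ᶠ p in (UU : Filter ℕ), v n p ≤ v n0 p + δ := by
  by_contra hc
  push Not at hc
  have key : ∀ M : ℕ, ∃ n, ∀ᶠ p in (UU : Filter ℕ), M * δ ≤ v n p := by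
    intro M
    induction M with
    | zero => exact ⟨0, Eventually.of_forall fun p => by simp⟩
    | succ M ih =>
      obtain ⟨n, hn⟩ := ih
      obtain ⟨n', _, hn'⟩ := hc n
      refine ⟨n', ?_⟩
      filter_upwards [hn, hn'] with p a b
      push_cast
      rw [add_mul, one_mul]
      exact (add_le_add a le_rfl).trans b.le
  obtain ⟨M, hM⟩ := exists_nat_gt (2 / δ)
  obtain ⟨n, hn⟩ := key M
  obtain ⟨p, hp⟩ := hn.exists
  have := hp.trans (hv n p)
  rw [div_lt_iff₀ hδ] at hM
  exact absurd this (not_le.2 hM)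

lemma Free_dep {n : ℕ} {X : Set TT} (z : TT) : Dep n (Free 0 n z X) := by
  intro x y hxy hx y' h1 h2
  exact hx y' h1 (fun i hi hin => by rw [h2 i hi hin, hxy i hin])

lemma Free0_inv {m n : ℕ} {X : Set TT} (hX : Inv m X) (z : TT) : Inv m (Free 0 n z X) := by
  intro x y hxy hx y' _ h2 hy'
  refine hx (spl m x y') (fun i hi => by omega) (fun i _ hin => ?_) (hX y' _ (fun i hi => ?_) hy')
  · by_cases him : i < m
    · simp [spl, him]
    · simp only [spl, him, if_false]
      rw [h2 i (by omega) hin, hxy i (by omega)]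
  · simp [spl, show ¬ i < m by omega]

lemma lemX {nm : Finset ℕ → ℕ} {GG} (h : NormOK nm GG) {k m : ℕ} {E : ℕ → Set TT} (hE : ∀ i, Inv m (E i))
    {nn : ℕ → ℕ} (hD : ∀ i, Dep (nn i) (E i))
    (hle : ∀ r, nu nm k (⋃ i ∈ Finset.range r, E i) ≤ 1) (η : ℝ≥0) (hη : 0 < η) :
    ∃ n0 C, Dep n0 C ∧ Inv m C ∧ nu nm k C ≤ ((5 / 2 : ℝ≥0) : ℝ≥0∞) ∧ ∀ i, nu nm k (E i \ C) ≤ η := by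
  obtain ⟨F, hF, hFs, hFc⟩ := fam h hE hle
  have hFs2 : ∀ p, ∑ e ∈ F p, e.2.2 ≤ 2 := fun p =>
    (hFs p).trans (by rw [← NNReal.coe_le_coe]; push_cast; norm_num)
  set v : ℕ → ℕ → ℝ≥0 := fun n p => ∑ e ∈ (F p).filter (fun e => Nr nm n e), e.2.2 with hv
  have hvm : ∀ n n' p, n ≤ n' → v n p ≤ v n' p := by
    intro n n' p hn
    apply Finset.sum_le_sum_of_subset
    intro e he
    rw [Finset.mem_filter] at *
    exact ⟨he.1, he.2.mono h hn⟩
  obtain ⟨n0, hn0⟩ := stab v (fun n p => (Finset.sum_le_sum_of_subset (Finset.filter_subset _ _)).trans (hFs2 p))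
    hvm (4 / 5 * η) (by positivity)
  set z0 : TT := fun _ => 0
  set Cp : ℕ → Set TT := fun p => ⋃ e ∈ (F p).filter (fun e => Nr nm n0 e), (Free 0 n0 z0 e.1)ᶜ with hCp
  have hCdep : ∀ p, Dep n0 (Cp p) := by
    intro p x y hxy hx
    simp only [hCp, Set.mem_iUnion] at hx ⊢
    obtain ⟨e, he, hx⟩ := hx
    exact ⟨e, he, (Free_dep z0).compl x y hxy hx⟩
  have hCinv : ∀ p, Inv m (Cp p) := by
    intro p x y hxy hx
    simp only [hCp, Set.mem_iUnion] at hx ⊢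
    obtain ⟨e, he, hx⟩ := hx
    exact ⟨e, he, (Free0_inv (hF p e (Finset.mem_filter.1 he).1).2 z0).compl x y hxy hx⟩
  have hC : ∃ C, ∀ᶠ p in (UU : Filter ℕ), Cp p = C := by
    have h1 := (Ultrafilter.finite_biUnion_mem_iff (f := UU) (finite_Dep n0) (s := fun C => {p | Cp p = C})).1
      (by
        have : (⋃ i ∈ {C | Dep n0 C}, {p | Cp p = i}) = Set.univ := by
          ext p
          simp [hCdep]
        rw [this]
        exact Filter.univ_mem)
    obtain ⟨C, _, hC⟩ := h1
    exact ⟨C, hC⟩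
  obtain ⟨C, hC⟩ := hC
  obtain ⟨p0, hp0⟩ := hC.exists
  refine ⟨n0, C, hp0 ▸ hCdep p0, hp0 ▸ hCinv p0, nu_le ?_, fun i => nu_le ?_⟩
  · filter_upwards [hC] with p hp
    rw [← hp]
    refine (phi_le_fam _ _ ((F p).filter (fun e => Nr nm n0 e)) (res 0 n0 z0 (5 / 4)) ?_ ?_).trans ?_
    · intro e he
      rw [Finset.mem_filter] at he
      exact head_mem (hF p e he.1).1 he.2 _
    · intro x hx
      simp only [hCp, Set.mem_iUnion] at hx
      obtain ⟨e, he, hx⟩ := hx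
      exact ⟨e, he, hx⟩
    · rw [ENNReal.coe_le_coe]
      simp only [res]
      rw [← Finset.mul_sum]
      calc 5 / 4 * ∑ e ∈ (F p).filter (fun e => Nr nm n0 e), e.2.2 ≤ 5 / 4 * (15 / 8) := by
            gcongr; exact (Finset.sum_le_sum_of_subset (Finset.filter_subset _ _)).trans (hFs p)
        _ ≤ 5 / 2 := by rw [← NNReal.coe_le_coe]; push_cast; norm_num
  · set n := max n0 (nn i) with hn
    filter_upwards [hC, hFc i, hn0 n (le_max_left _ _)] with p hp hcov hvp
    rw [← hp]
    refine (phi_le_fam _ _ ((F p).filter (fun e => Nr nm n e ∧ ¬ Nr nm n0 e)) (res 0 n z0 (5 / 4)) ?_ ?_).trans ?_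
    · intro e he
      rw [Finset.mem_filter] at he
      exact head_mem (hF p e he.1).1 he.2.1 _
    · rintro x ⟨hxE, hxC⟩
      by_contra hc
      push Not at hc
      obtain ⟨y, hy⟩ := tail_avoid h (F p) (fun e he => (hF p e he).1) (hFs2 p) n x
      obtain ⟨e, he, hxe⟩ := hcov (spl n x y) (hD i x _ (fun j hj => by
        have : nn i ≤ n := le_max_right _ _
        simp [spl, show j < n by omega]) hxE)
      have hN : Nr nm n e := by
        by_contra hN
        exact hy e he hN hxe
      by_cases hN0 : Nr nm n0 e
      · apply hxC
        simp only [hCp, Set.mem_iUnion]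
        refine ⟨e, Finset.mem_filter.2 ⟨he, hN0⟩, fun hfree => ?_⟩
        refine hfree (spl n x y) (fun i hi => by omega) (fun i _ hi => ?_) hxe
        have : n0 ≤ n := le_max_left _ _
        simp [spl, show i < n by omega]
      · have := mem_res.1 (hc e (Finset.mem_filter.2 ⟨he, hN, hN0⟩))
        exact this (spl n x y) (fun i hi => by omega) (fun i _ hi => by simp [spl, hi]) hxe
    · rw [ENNReal.coe_le_coe]
      simp only [res]
      rw [← Finset.mul_sum]
      have h1 : ∑ e ∈ (F p).filter (fun e => Nr nm n e ∧ ¬ Nr nm n0 e), e.2.2 + v n0 p ≤ v n p := by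
        simp only [hv]
        rw [← Finset.sum_union]
        · apply Finset.sum_le_sum_of_subset
          intro e he
          rw [Finset.mem_union, Finset.mem_filter, Finset.mem_filter] at he
          rw [Finset.mem_filter]
          rcases he with he | he
          · exact ⟨he.1, he.2.1⟩
          · exact ⟨he.1, he.2.mono h (le_max_left _ _)⟩
        · rw [Finset.disjoint_left]
          intro e h1 h2
          exact (Finset.mem_filter.1 h1).2.2 (Finset.mem_filter.1 h2).2
      have h2 : ∑ e ∈ (F p).filter (fun e => Nr nm n e ∧ ¬ Nr nm n0 e), e.2.2 ≤ 4 / 5 * η := by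
        have := h1.trans hvp
        rw [add_comm] at this
        exact le_of_add_le_add_left this
      calc 5 / 4 * ∑ e ∈ (F p).filter (fun e => Nr nm n e ∧ ¬ Nr nm n0 e), e.2.2 ≤ 5 / 4 * (4 / 5 * η) := by
            gcongr
        _ = η := by rw [← mul_assoc]; norm_num

lemma step {nm : Finset ℕ → ℕ} {GG} (h : NormOK nm GG) (k : ℕ) {E : ℕ → Set TT}
    {nn : ℕ → ℕ} (hD : ∀ i, Dep (nn i) (E i)) (hdj : ∀ i j, i ≠ j → Disjoint (E i) (E j))
    (m : ℕ) (z : TT) (η : ℝ≥0) (hη : 0 < η) :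
    ∃ n r C, Dep n C ∧ Inv m C ∧ 1 < nu nm (k + 1) Cᶜ ∧
      ∀ i, r ≤ i → nu nm (k + 1) ({x | spl m z x ∈ E i} \ C) ≤ η := by
  set P : ℕ → Set TT := fun i => {x | spl m z x ∈ E i} with hP
  have hPI : ∀ i, Inv m (P i) := by
    intro i x y hxy hx
    have : spl m z y = spl m z x := by
      funext j
      by_cases hj : j < m
      · simp [spl, hj]
      · simp [spl, hj, hxy j (by omega)]
    simp only [hP, Set.mem_ofPred_eq] at *
    rwa [this]
  have hPD : ∀ i, Dep (nn i) (P i) := by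
    intro i x y hxy hx
    refine hD i _ _ (fun j hj => ?_) hx
    by_cases hjm : j < m
    · simp [spl, hjm]
    · simp [spl, hjm, hxy j hj]
  by_cases hc : ∃ r, 1 < nu nm (k + 1) (⋃ i ∈ Finset.range r, P i)
  · obtain ⟨r, hr⟩ := hc
    refine ⟨(Finset.range r).sup nn, r, (⋃ i ∈ Finset.range r, P i)ᶜ, ?_, ?_, ?_, ?_⟩
    · apply Dep.compl
      intro x y hxy hx
      simp only [Set.mem_iUnion] at hx ⊢
      obtain ⟨i, hi, hx⟩ := hx
      exact ⟨i, hi, (hPD i).mono (Finset.le_sup hi) x y hxy hx⟩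
    · apply Inv.compl
      intro x y hxy hx
      simp only [Set.mem_iUnion] at hx ⊢
      obtain ⟨i, hi, hx⟩ := hx
      exact ⟨i, hi, hPI i x y hxy hx⟩
    · rwa [compl_compl]
    · intro i hi
      have : P i \ (⋃ i ∈ Finset.range r, P i)ᶜ = ∅ := by
        rw [Set.eq_empty_iff_forall_notMem]
        rintro x ⟨hx, hx2⟩
        rw [Set.mem_compl_iff, not_not] at hx2
        simp only [Set.mem_iUnion, Finset.mem_range] at hx2
        obtain ⟨j, hj, hx2⟩ := hx2
        exact Set.disjoint_left.1 (hdj i j (by omega)) hx hx2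
      rw [this, nu_empty]
      exact zero_le
  · push Not at hc
    obtain ⟨n0, C, h1, h2, h3, h4⟩ := lemX h hPI hPD hc η hη
    refine ⟨n0, 0, C, h1, h2, ?_, fun i _ => h4 i⟩
    by_contra hcon
    push Not at hcon
    have a := nu_univ h (k + 1)
    have b := nu_union (nm := nm) (k := k + 1) C Cᶜ
    rw [Set.union_compl_self] at b
    have c : ((cc (k + 1) : ℝ≥0) : ℝ≥0∞) ≤ ((5 / 2 + 1 : ℝ≥0) : ℝ≥0∞) := by
      rw [ENNReal.coe_add, ENNReal.coe_one]
      exact a.trans (b.trans (add_le_add h3 hcon))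
    rw [ENNReal.coe_le_coe] at c
    have d := (cc_ge' k).trans c
    rw [← NNReal.coe_le_coe] at d
    push_cast at d
    norm_num at d

lemma tr_spl (m : ℕ) (y : TT) : spl m (tr m y) y = y := by
  funext i
  by_cases hi : i < m <;> simp [tr, spl, hi]

lemma step2 {nm : Finset ℕ → ℕ} {GG} (h : NormOK nm GG) (k : ℕ) {E : ℕ → Set TT}
    {nn : ℕ → ℕ} (hD : ∀ i, Dep (nn i) (E i)) (hdj : ∀ i j, i ≠ j → Disjoint (E i) (E j))
    (m : ℕ) (η : ℝ≥0) (hη : 0 < η) :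
    ∃ n r, m < n ∧ ∀ i, r ≤ i → ∃ R : Set TT, nu nm (k + 1) R ≤ η ∧
      ∀ n', n ≤ n' → ∀ z, 1 < nu nm (k + 1) (Free m n' z (E i \ R)) := by
  set S := (finite_tr m).toFinset with hS
  set η' : ℝ≥0 := η / (S.card + 1) with hη'
  have hη'0 : 0 < η' := by positivity
  have key := fun z => step h k hD hdj m z η' hη'0
  choose n r C h1 h2 h3 h4 using key
  have hmem : ∀ z, tr m z ∈ S := by intro z; simp [hS]
  refine ⟨m + 1 + S.sup n, S.sup r, by omega, fun i hi => ?_⟩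
  refine ⟨{y | y ∈ E i ∧ y ∉ C (tr m y)}, ?_, ?_⟩
  · have : {y | y ∈ E i ∧ y ∉ C (tr m y)} ⊆ ⋃ t ∈ S, ({x | spl m t x ∈ E i} \ C t) := by
      rintro y ⟨hy1, hy2⟩
      simp only [Set.mem_iUnion]
      refine ⟨tr m y, hmem y, ?_, hy2⟩
      rw [Set.mem_ofPred_eq, tr_spl]; exact hy1
    refine (nu_mono this).trans ((nu_biUnion _ _).trans ?_)
    calc ∑ t ∈ S, nu nm (k + 1) ({x | spl m t x ∈ E i} \ C t) ≤ ∑ _t ∈ S, (η' : ℝ≥0∞) :=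
          Finset.sum_le_sum fun t ht => h4 t i ((Finset.le_sup ht).trans hi)
      _ = ((S.card * η' : ℝ≥0) : ℝ≥0∞) := by simp
      _ ≤ η := by
        rw [ENNReal.coe_le_coe, hη', mul_div_assoc']
        rw [div_le_iff₀ (by positivity), mul_comm]
        gcongr
        exact le_self_add
  · intro n' hn' z
    refine (h3 (tr m z)).trans_le (nu_mono ?_)
    intro x hx y hy1 hy2 hy
    have ht : tr m y = tr m z := tr_eq hy1
    apply hy.2
    refine ⟨hy.1, ?_⟩
    rw [ht]
    intro hyC
    apply hx
    have hle : n (tr m z) ≤ n' := (Finset.le_sup (hmem z)).trans (by omega)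
    have a : spl m y x ∈ C (tr m z) := (h1 (tr m z)).mono hle y _ (fun i hi => by
      by_cases him : i < m
      · simp [spl, him]
      · simp [spl, him, hy2 i (by omega) hi]) hyC
    exact h2 (tr m z) _ _ (fun i hi => by simp [spl, show ¬ i < m by omega]) a
lemma Free_congr {m n : ℕ} {z z' : TT} (h : ∀ i, i < m → z i = z' i) (X : Set TT) :
    Free m n z X ⊆ Free m n z' X :=
  fun _ hx y h1 h2 => hx y (fun i hi => by rw [h1 i hi, h i hi]) h2

lemma Free_anti {m n : ℕ} {z : TT} {X X' : Set TT} (h : X' ⊆ X) : Free m n z X ⊆ Free m n z X' :=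
  fun _ hx y h1 h2 h3 => hx y h1 h2 (h h3)

lemma geo (I : Finset ℕ) : ∑ m ∈ I, ((1 / 2 : ℝ≥0) ^ (m + 1)) ≤ 1 := by
  have h1 : Summable (fun m : ℕ => (1 / 2 : ℝ) ^ (m + 1)) := by
    have := (summable_geometric_two).mul_left (1 / 2 : ℝ)
    refine this.congr fun m => ?_
    rw [pow_succ]; ring
  have h2 : ∑' m : ℕ, (1 / 2 : ℝ) ^ (m + 1) = 1 := by
    have : ∀ m : ℕ, (1 / 2 : ℝ) ^ (m + 1) = (1 / 2) * (1 / 2) ^ m := fun m => by rw [pow_succ]; ring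
    simp_rw [this]
    rw [tsum_mul_left, tsum_geometric_two]; norm_num
  have h3 := h1.sum_le_tsum I (fun m _ => by positivity)
  rw [h2] at h3
  rw [← NNReal.coe_le_coe]
  push_cast
  exact h3

lemma concl {nm : Finset ℕ → ℕ} {GG} (h : NormOK nm GG)
    (hinf : ∀ J : Set ℕ, J.Infinite → ∀ N, ∃ I : Finset ℕ, (I : Set ℕ) ⊆ J ∧ N ≤ nm I) (k : ℕ) {E : ℕ → Set TT}
    {nn : ℕ → ℕ} (hD : ∀ i, Dep (nn i) (E i)) (hdj : ∀ i j, i ≠ j → Disjoint (E i) (E j)) :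
    ∃ i, nu nm k (E i) ≤ ((2 * (1 / 2) ^ k : ℝ≥0) : ℝ≥0∞) := by
  have key := fun m => step2 h k hD hdj m ((1 / 2) ^ k * (1 / 2) ^ (m + 1)) (by positivity)
  choose n r hmn hR using key
  set a : ℕ → ℕ := fun s => n^[s] 0 with ha
  have hasucc : ∀ s, a (s + 1) = n (a s) := fun s => Function.iterate_succ_apply' n s 0
  have hamono : StrictMono a := strictMono_nat_of_lt_succ fun s => by rw [hasucc]; exact hmn _
  obtain ⟨I, hIJ, hIN⟩ := hinf (Set.range a) (Set.infinite_range_of_injective hamono.injective) (NN k)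
  set i := I.sup r with hi
  have hR' : ∀ m, ∃ R : Set TT, m ∈ I → (nu nm (k + 1) R ≤ (((1 / 2) ^ k * (1 / 2) ^ (m + 1) : ℝ≥0) : ℝ≥0∞) ∧
      ∀ n', n m ≤ n' → ∀ z, 1 < nu nm (k + 1) (Free m n' z (E i \ R))) := by
    intro m
    by_cases hm : m ∈ I
    · obtain ⟨R, h1⟩ := hR m i (Finset.le_sup hm)
      exact ⟨R, fun _ => h1⟩
    · exact ⟨∅, fun h => absurd h hm⟩
  choose R hR' using hR'
  refine ⟨i, ?_⟩
  set X : Set TT := E i \ ⋃ m ∈ I, R m with hX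
  have hthin : ∀ m ∈ I, ∀ m' ∈ I, m < m' → ∀ z, 1 < nu nm (k + 1) (Free m m' z X) := by
    intro m hm m' hm' hlt z
    obtain ⟨s, hs⟩ := hIJ hm
    obtain ⟨t, ht⟩ := hIJ hm'
    have hst : s < t := by
      rw [← hs, ← ht] at hlt
      exact hamono.lt_iff_lt.1 hlt
    have hle : n m ≤ m' := by
      rw [← hs, ← ht, ← hasucc]
      exact hamono.monotone hst
    refine ((hR' m hm).2 m' hle z).trans_le (nu_mono (Free_anti ?_))
    intro x hx
    refine ⟨hx.1, fun hxR => hx.2 ?_⟩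
    simp only [Set.mem_iUnion]
    exact ⟨m, hm, hxR⟩
  have hev : ∀ᶠ p in (UU : Filter ℕ), ∀ m ∈ I, ∀ m' ∈ I, m < m' → ∀ z, 1 ≤ mu nm (k + 1) p (Free m m' z X) := by
    rw [Filter.eventually_all_finset]
    intro m hm
    rw [Filter.eventually_all_finset]
    intro m' hm'
    by_cases hlt : m < m'
    · have h1 : ∀ᶠ p in (UU : Filter ℕ), ∀ t ∈ Set.range (tr m), 1 < mu nm (k + 1) p (Free m m' t X) := by
        rw [Filter.eventually_all_finite (finite_tr m)]
        intro t _
        exact ev_gt (hthin m hm m' hm' hlt t)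
      filter_upwards [h1] with p hp _ z
      refine (hp (tr m z) ⟨z, rfl⟩).le.trans (phi_mono _ (Free_congr ?_ X))
      intro j hj
      simp [tr, spl, hj]
    · exact Eventually.of_forall fun p h => absurd h hlt
  have hpow : (2 : ℝ≥0) ^ k * (1 / 2) ^ k = 1 := by rw [← mul_pow]; norm_num
  have hXk : nu nm k X ≤ (((1 / 2) ^ k : ℝ≥0) : ℝ≥0∞) := by
    refine nu_le ?_
    filter_upwards [hev, ev_ge (k + 1)] with p hp hpk
    have hmem : ((X, I, (1 / 2) ^ k) : El) ∈ Cl nm (p - k) k := by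
      have h1 : p - k = (p - (k + 1)) + 1 := by omega
      rw [h1]
      refine Or.inr ⟨?_, ?_, hp⟩
      · simp only [hpow]; exact le_rfl
      · simp only [hpow, one_pow, mul_one]; exact_mod_cast hIN
    have := phi_le (Cl nm (p - k) k) X {(X, I, (1 / 2) ^ k)} (by simpa using hmem) (fun x hx => ⟨_, Finset.mem_singleton_self _, hx⟩)
    rw [Finset.sum_singleton] at this
    exact this
  have hsub : E i ⊆ X ∪ ⋃ m ∈ I, R m := by
    intro x hx
    by_cases hxR : x ∈ ⋃ m ∈ I, R m
    · exact Or.inr hxR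
    · exact Or.inl ⟨hx, hxR⟩
  have hRs : nu nm k (⋃ m ∈ I, R m) ≤ (((1 / 2) ^ k : ℝ≥0) : ℝ≥0∞) := by
    refine (nu_succ _).trans ((nu_biUnion _ _).trans ((Finset.sum_le_sum fun m hm => (hR' m hm).1).trans ?_))
    rw [← ENNReal.ofNNReal_finsetSum, ENNReal.coe_le_coe, ← Finset.mul_sum]
    exact mul_le_of_le_one_right zero_le (geo I)
  refine (nu_mono hsub).trans ((nu_union _ _).trans ((add_le_add hXk hRs).trans ?_))
  rw [← ENNReal.coe_add, ENNReal.coe_le_coe, two_mul]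

lemma exh {nm : Finset ℕ → ℕ} {GG} (h : NormOK nm GG)
    (hinf : ∀ J : Set ℕ, J.Infinite → ∀ N, ∃ I : Finset ℕ, (I : Set ℕ) ⊆ J ∧ N ≤ nm I) {E : ℕ → Set TT}
    {nn : ℕ → ℕ} (hD : ∀ i, Dep (nn i) (E i)) (hdj : ∀ i j, i ≠ j → Disjoint (E i) (E j)) :
    Tendsto (fun i => nu nm 0 (E i)) atTop (nhds 0) := by
  rw [ENNReal.tendsto_nhds_zero]
  intro ε hε
  by_contra hc
  rw [Filter.not_eventually] at hc
  obtain ⟨f, hf, hf2⟩ := Filter.extraction_of_frequently_atTop hc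
  have : ∃ k : ℕ, ((2 * (1 / 2) ^ k : ℝ≥0) : ℝ≥0∞) ≤ ε := by
    have h1 : Tendsto (fun k : ℕ => (2 * (1 / 2 : ℝ≥0) ^ k : ℝ≥0)) atTop (nhds 0) := by
      have := (tendsto_pow_atTop_nhds_zero_of_lt_one (r := (1 / 2 : ℝ≥0)) zero_le (by
        rw [← NNReal.coe_lt_coe]; push_cast; norm_num)).const_mul 2
      simpa using this
    have h2 := ENNReal.tendsto_coe.2 h1
    rw [ENNReal.coe_zero, ENNReal.tendsto_nhds_zero] at h2
    exact (h2 ε hε).exists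
  obtain ⟨k, hk⟩ := this
  obtain ⟨i, hi⟩ := concl h hinf k (E := fun i => E (f i)) (nn := fun i => nn (f i)) (fun i => hD _)
    (fun i j hij => hdj _ _ (hf.injective.ne hij))
  exact hf2 i ((nu_zero_le _ k).trans (hi.trans hk))

lemma clopen_dep {X : Set TT} (hX : IsClopen X) : ∃ n, Dep n X := by
  have loc : ∀ (W : Set TT), IsOpen W → ∀ x ∈ W, ∃ n, PiNat.cylinder x n ⊆ W := by
    intro W hW x hx
    obtain ⟨V, ⟨y, n, rfl⟩, h1, h2⟩ := (PiNat.isTopologicalBasis_cylinders (fun n : ℕ => Fin (2 ^ n))).exists_subset_of_mem_open hx hW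
    refine ⟨n, ?_⟩
    rw [PiNat.mem_cylinder_iff_eq.1 h1]
    exact h2
  have key : ∀ x : TT, ∃ n, PiNat.cylinder x n ⊆ X ∨ PiNat.cylinder x n ⊆ Xᶜ := by
    intro x
    by_cases hx : x ∈ X
    · obtain ⟨n, hn⟩ := loc X hX.isOpen x hx
      exact ⟨n, Or.inl hn⟩
    · obtain ⟨n, hn⟩ := loc Xᶜ hX.compl.isOpen x hx
      exact ⟨n, Or.inr hn⟩
  choose n hn using key
  obtain ⟨t, _, ht⟩ := (isCompact_univ (X := TT)).elim_nhds_subcover (fun x => PiNat.cylinder x (n x))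
    (fun x _ => (PiNat.isOpen_cylinder (fun n : ℕ => Fin (2 ^ n)) x (n x)).mem_nhds (PiNat.self_mem_cylinder x (n x)))
  refine ⟨t.sup n, fun x y hxy hx => ?_⟩
  have := ht (Set.mem_univ x)
  simp only [Set.mem_iUnion] at this
  obtain ⟨u, hu, hxu⟩ := this
  have hyu : y ∈ PiNat.cylinder u (n u) := by
    intro i hi
    rw [← hxy i (lt_of_lt_of_le hi (Finset.le_sup hu))]
    exact hxu i hi
  rcases hn u with h | h
  · exact h hyu
  · exact absurd hx (h hxu)

/-- The submeasure obtained from a norm. -/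
theorem exists_sub {nm : Finset ℕ → ℕ} {GG} (h : NormOK nm GG)
    (hinf : ∀ J : Set ℕ, J.Infinite → ∀ N, ∃ I : Finset ℕ, (I : Set ℕ) ⊆ J ∧ N ≤ nm I) :
    ∃ f : BAlg → ℝ≥0∞, IsSubmeasurePt f ∧ IsExhaustivePt f ∧
      ∀ G ∈ GG, ∀ q : TT, ∀ B : BAlg, Y G q ⊆ B.1 → 1 ≤ f B := by
  refine ⟨fun B => nu nm 0 B.1, ⟨nu_empty, fun X Y hXY => nu_mono hXY, fun X Y => nu_union _ _⟩, ?_, ?_⟩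
  · intro E hE
    choose nn hnn using fun i => clopen_dep (E i).2
    exact exh h hinf hnn hE
  · intro G hG q B hB
    refine le_trans ?_ ((nu_claim h hG q 0).trans (nu_mono hB))
    rw [← ENNReal.coe_one, ENNReal.coe_le_coe]
    refine le_trans ?_ (cc_ge 0)
    rw [← NNReal.coe_le_coe]; push_cast; norm_num
def OKN (rel : ℕ → ℕ → Prop) (I : Finset ℕ) (N : ℕ) : Prop :=
  ∃ col h : ℕ → ℕ, ∀ b ∈ I, col b < N ∧ h b ≤ b ∧
    ∀ b' ∈ I, b ≠ b' → col b = col b' → h b ≠ h b' ∧ rel (h b) (h b')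

noncomputable def nmR (rel : ℕ → ℕ → Prop) (I : Finset ℕ) : ℕ := sInf {N | OKN rel I N}

lemma OKN_card (rel : ℕ → ℕ → Prop) (I : Finset ℕ) : OKN rel I I.card := by
  have key : ∀ b ∈ I, ∀ b' : ℕ, b < b' → (I.filter (fun x => x < b)).card < (I.filter (fun x => x < b')).card := by
    intro b hb b' hlt
    apply Finset.card_lt_card
    rw [Finset.ssubset_iff_of_subset]
    · exact ⟨b, by simp [hb, hlt], by simp⟩
    · intro x hx
      rw [Finset.mem_filter] at *
      exact ⟨hx.1, by omega⟩
  refine ⟨fun b => (I.filter (fun x => x < b)).card, fun b => b, fun b hb => ⟨?_, le_rfl, ?_⟩⟩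
  · apply Finset.card_lt_card
    rw [Finset.ssubset_iff_of_subset (Finset.filter_subset _ _)]
    exact ⟨b, hb, by simp⟩
  · intro b' hb' hne heq
    exfalso
    simp only at heq
    rcases lt_or_gt_of_ne hne with hlt | hlt
    · have := key b hb b' hlt; omega
    · have := key b' hb' b hlt; omega

lemma nmR_spec (rel : ℕ → ℕ → Prop) (I : Finset ℕ) : OKN rel I (nmR rel I) :=
  Nat.sInf_mem (s := {N | OKN rel I N}) ⟨_, OKN_card rel I⟩

lemma nmR_le {rel : ℕ → ℕ → Prop} {I : Finset ℕ} {N : ℕ} (h : OKN rel I N) : nmR rel I ≤ N := Nat.sInf_le h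

def cliques (rel : ℕ → ℕ → Prop) : Set (Finset ℕ) := {G | ∀ a ∈ G, ∀ b ∈ G, a ≠ b → rel a b}

lemma nmR_mono (rel : ℕ → ℕ → Prop) {I J : Finset ℕ} (h : I ⊆ J) : nmR rel I ≤ nmR rel J := by
  obtain ⟨col, g, hg⟩ := nmR_spec rel J
  exact nmR_le ⟨col, g, fun b hb => ⟨(hg b (h hb)).1, (hg b (h hb)).2.1, fun b' hb' => (hg b (h hb)).2.2 b' (h hb')⟩⟩

lemma nmR_sub (rel : ℕ → ℕ → Prop) (I J : Finset ℕ) : nmR rel (I ∪ J) ≤ nmR rel I + nmR rel J := by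
  obtain ⟨c1, g1, h1⟩ := nmR_spec rel I
  obtain ⟨c2, g2, h2⟩ := nmR_spec rel J
  refine nmR_le ⟨fun b => if b ∈ I then c1 b else nmR rel I + c2 b, fun b => if b ∈ I then g1 b else g2 b, ?_⟩
  intro b hb
  rw [Finset.mem_union] at hb
  by_cases hbI : b ∈ I
  · have a := h1 b hbI
    simp only [hbI, if_true]
    refine ⟨by omega, a.2.1, fun b' hb' hne => ?_⟩
    by_cases hbI' : b' ∈ I
    · simp only [hbI', if_true]
      exact a.2.2 b' hbI' hne
    · simp only [hbI', if_false]
      intro h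
      omega
  · have hbJ : b ∈ J := hb.resolve_left hbI
    have a := h2 b hbJ
    simp only [hbI, if_false]
    refine ⟨by omega, a.2.1, fun b' hb' hne => ?_⟩
    by_cases hbI' : b' ∈ I
    · have := h1 b' hbI'
      simp only [hbI', if_true]
      intro h
      omega
    · rw [Finset.mem_union] at hb'
      simp only [hbI', if_false]
      intro h
      exact a.2.2 b' (hb'.resolve_left hbI') hne (by omega)

lemma nmR_good (rel : ℕ → ℕ → Prop) (G : Finset ℕ) (hG : G ∈ cliques rel) (I : Finset ℕ) :
    nmR rel I ≤ (gd G I).card + 2 := by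
  set Bad := I.filter (fun b => ∃ g ∈ G, g < b ∧ ∀ a ∈ I, a < b → a ≤ g) with hBad
  have hB : nmR rel Bad ≤ 1 := by
    have : ∀ b, ∃ g, b ∈ Bad → g ∈ G ∧ g < b ∧ ∀ a ∈ I, a < b → a ≤ g := by
      intro b
      by_cases hb : b ∈ Bad
      · obtain ⟨g, h⟩ := (Finset.mem_filter.1 hb).2
        exact ⟨g, fun _ => h⟩
      · exact ⟨0, fun h => absurd h hb⟩
    choose g hg using this
    refine nmR_le ⟨fun _ => 0, g, fun b hb => ⟨by simp, (hg b hb).2.1.le, fun b' hb' hne _ => ?_⟩⟩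
    have h1 := hg b hb
    have h2 := hg b' hb'
    have hbI := (Finset.mem_filter.1 hb).1
    have hbI' := (Finset.mem_filter.1 hb').1
    have hne' : g b ≠ g b' := by
      rcases lt_or_gt_of_ne hne with hlt | hlt
      · have := h2.2.2 b hbI hlt; omega
      · have := h1.2.2 b' hbI' hlt; omega
    exact ⟨hne', hG _ h1.1 _ h2.1 hne'⟩
  have hsub : I \ Bad ⊆ insert (sInf (I : Set ℕ)) ((gd G I).image Prod.snd) := by
    intro b hb
    rw [Finset.mem_sdiff] at hb
    rw [Finset.mem_insert]
    by_cases hne : (I.filter (fun x => x < b)).Nonempty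
    · right
      have hm := Finset.max'_mem _ hne
      set a := (I.filter (fun x => x < b)).max' hne with ha
      have hmax : ∀ x ∈ I, x < b → x ≤ a := fun x h1 h2 => Finset.le_max' _ _ (Finset.mem_filter.2 ⟨h1, h2⟩)
      rw [Finset.mem_filter] at hm
      rw [Finset.mem_image]
      refine ⟨(a, b), ?_, rfl⟩
      rw [gd, Finset.mem_filter, Finset.mem_product]
      refine ⟨⟨hm.1, hb.1⟩, hm.2, ?_, ?_⟩
      · rintro c hc ⟨h1, h2⟩
        have := hmax c hc h2
        simp only at h1
        omega
      · rintro g hg ⟨h1, h2⟩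
        apply hb.2
        rw [hBad, Finset.mem_filter]
        exact ⟨hb.1, g, hg, h2, fun x hx hxb => (hmax x hx hxb).trans h1⟩
    · left
      have h1 : sInf (I : Set ℕ) ∈ (I : Set ℕ) := Nat.sInf_mem ⟨b, hb.1⟩
      have h2 : sInf (I : Set ℕ) ≤ b := Nat.sInf_le hb.1
      by_contra hne2
      exact hne ⟨_, Finset.mem_filter.2 ⟨h1, by omega⟩⟩
  have h1 : (I \ Bad).card ≤ (gd G I).card + 1 := by
    refine (Finset.card_le_card hsub).trans ((Finset.card_insert_le _ _).trans ?_)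
    have := Finset.card_image_le (s := gd G I) (f := Prod.snd)
    omega
  have h2 : nmR rel (I \ Bad) ≤ (I \ Bad).card := nmR_le (OKN_card rel _)
  have h3 := nmR_sub rel Bad (I \ Bad)
  have h4 : Bad ∪ (I \ Bad) = I := by
    rw [Finset.union_sdiff_of_subset (Finset.filter_subset _ _)]
  rw [h4] at h3
  omega

lemma normOK (rel : ℕ → ℕ → Prop) : NormOK (nmR rel) (cliques rel) where
  mono := fun _ _ h => nmR_mono rel h
  sub := nmR_sub rel
  card := fun I => nmR_le (OKN_card rel I)
  good := nmR_good rel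
  emp := by simp [cliques]

lemma ev_const {f : ℕ → ℕ} {M : ℕ} (h : ∀ᶠ n in (UU : Filter ℕ), f n ≤ M) :
    ∃ c, ∀ᶠ n in (UU : Filter ℕ), f n = c := by
  have h1 := (Ultrafilter.finite_biUnion_mem_iff (f := UU) (Set.finite_Iic M) (s := fun C => {p | f p = C})).1
      (by
        refine Filter.mem_of_superset h ?_
        intro n hn
        simp only [Set.mem_iUnion]
        exact ⟨f n, hn, rfl⟩)
  obtain ⟨C, _, hC⟩ := h1
  exact ⟨C, hC⟩

lemma nmR_inf (rel : ℕ → ℕ → Prop)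
    (hrel : ∀ K : Set ℕ, K.Infinite → ¬ ∀ a ∈ K, ∀ b ∈ K, a ≠ b → rel a b) :
    ∀ J : Set ℕ, J.Infinite → ∀ N, ∃ I : Finset ℕ, (I : Set ℕ) ⊆ J ∧ N ≤ nmR rel I := by
  intro J hJ N
  by_contra hc
  push Not at hc
  have key : ∀ n : ℕ, OKN rel ((Finset.range n).filter (fun x => x ∈ J)) N := by
    intro n
    have h1 := hc ((Finset.range n).filter (fun x => x ∈ J)) (by
      intro x hx
      rw [Finset.mem_coe, Finset.mem_filter] at hx
      exact hx.2)
    obtain ⟨c, g, h⟩ := nmR_spec rel ((Finset.range n).filter (fun x => x ∈ J))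
    exact ⟨c, g, fun b hb => ⟨(h b hb).1.trans h1, (h b hb).2⟩⟩
  choose c g h using key
  have hmem : ∀ b ∈ J, ∀ᶠ n in (UU : Filter ℕ), b ∈ (Finset.range n).filter (fun x => x ∈ J) := by
    intro b hb
    filter_upwards [ev_ge (b + 1)] with n hn
    rw [Finset.mem_filter, Finset.mem_range]
    exact ⟨by omega, hb⟩
  have hC : ∀ b, ∃ C, b ∈ J → ∀ᶠ n in (UU : Filter ℕ), c n b = C := by
    intro b
    by_cases hb : b ∈ J
    · obtain ⟨C, hC⟩ := ev_const (f := fun n => c n b) (M := N) (by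
        filter_upwards [hmem b hb] with n hn
        exact (h n b hn).1.le)
      exact ⟨C, fun _ => hC⟩
    · exact ⟨0, fun h => absurd h hb⟩
  have hg : ∀ b, ∃ C, b ∈ J → ∀ᶠ n in (UU : Filter ℕ), g n b = C := by
    intro b
    by_cases hb : b ∈ J
    · obtain ⟨C, hC⟩ := ev_const (f := fun n => g n b) (M := b) (by
        filter_upwards [hmem b hb] with n hn
        exact (h n b hn).2.1)
      exact ⟨C, fun _ => hC⟩
    · exact ⟨0, fun h => absurd h hb⟩
  choose C hC using hC
  choose γ hγ using hg
  have hCN : ∀ b ∈ J, C b < N := by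
    intro b hb
    obtain ⟨n, h1, h2⟩ := ((hmem b hb).and (hC b hb)).exists
    rw [← h2]
    exact (h n b h1).1
  have hpair : ∀ b ∈ J, ∀ b' ∈ J, b ≠ b' → C b = C b' → γ b ≠ γ b' ∧ rel (γ b) (γ b') := by
    intro b hb b' hb' hne heq
    obtain ⟨n, h1, h2, h3, h4, h5, h6⟩ := ((hmem b hb).and ((hmem b' hb').and ((hC b hb).and ((hC b' hb').and
      ((hγ b hb).and (hγ b' hb')))))).exists
    rw [← h5, ← h6]
    exact (h n b h1).2.2 b' h2 hne (by rw [h3, h4, heq])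
  have : ∃ d, (J ∩ {b | C b = d}).Infinite := by
    by_contra hcon
    push Not at hcon
    apply hJ
    have h1 : J ⊆ ⋃ d ∈ Set.Iio N, (J ∩ {b | C b = d}) := by
      intro b hb
      simp only [Set.mem_iUnion]
      exact ⟨C b, hCN b hb, hb, rfl⟩
    refine Set.Finite.subset ?_ h1
    exact (Set.finite_Iio N).biUnion fun d _ => by simpa [Set.not_infinite] using hcon d
  obtain ⟨d, hd⟩ := this
  refine hrel (γ '' (J ∩ {b | C b = d})) (hd.image ?_) ?_
  · intro b hb b' hb' heq
    by_contra hne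
    exact (hpair b hb.1 b' hb'.1 hne (hb.2.trans hb'.2.symm)).1 heq
  · rintro _ ⟨b, hb, rfl⟩ _ ⟨b', hb', rfl⟩ hne
    exact (hpair b hb.1 b' hb'.1 (fun h => hne (by rw [h])) (hb.2.trans hb'.2.symm)).2

theorem exists_sub_rel (rel : ℕ → ℕ → Prop)
    (hrel : ∀ K : Set ℕ, K.Infinite → ¬ ∀ a ∈ K, ∀ b ∈ K, a ≠ b → rel a b) :
    ∃ f : BAlg → ℝ≥0∞, IsSubmeasurePt f ∧ IsExhaustivePt f ∧
      ∀ G ∈ cliques rel, ∀ q : TT, ∀ B : BAlg, Y G q ⊆ B.1 → 1 ≤ f B :=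
  exists_sub (normOK rel) (nmR_inf rel hrel)
def pre (b : ℕ → ℕ) (n : ℕ) : List ℕ := (List.range n).map b

lemma pre_length (b : ℕ → ℕ) (n : ℕ) : (pre b n).length = n := by simp [pre]

lemma pre_take (b : ℕ → ℕ) (n i : ℕ) : (pre b n).take i = pre b (min i n) := by
  simp [pre, ← List.map_take, List.take_range]

lemma pre_prefix {b : ℕ → ℕ} {n : ℕ} {l : List ℕ} (h : l <+: pre b n) : l = pre b l.length := by
  have h1 := List.prefix_iff_eq_take.1 h
  have h2 := h.length_le
  rw [pre_length] at h2
  rw [pre_take, min_eq_left h2] at h1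
  exact h1

def SP (g : (ℕ → ℕ) → (List ℕ → Bool)) (l : List ℕ) : Prop :=
  ∃ y : ℕ → ℕ, pre y l.length = l ∧ ∀ l' : List ℕ, ∀ _h : l'.length < l.length, Encodable.encode l' < l.length →
    (g y l' = true ↔ SP g l')
termination_by l.length

def WF : Set (List ℕ → Bool) := {S | ¬ ∃ b : ℕ → ℕ, ∀ n, S (pre b n) = true}

lemma WF_not_analytic : ¬ MeasureTheory.AnalyticSet WF := by
  intro h
  rw [MeasureTheory.AnalyticSet] at h
  rcases h with h | ⟨g, hg, hr⟩
  · have : (fun _ => false : List ℕ → Bool) ∈ WF := by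
      rintro ⟨b, hb⟩
      simpa using hb 0
    rw [h] at this
    exact this
  set S : List ℕ → Bool := fun l => decide (SP g l) with hS
  have hST : ∀ l, S l = true ↔ SP g l := fun l => by simp [hS]
  have hmem : S ∈ WF := by
    rintro ⟨b, hb⟩
    have key : ∀ n, ∃ y : ℕ → ℕ, pre y n = pre b n ∧ ∀ l' : List ℕ, l'.length < n → Encodable.encode l' < n →
        g y l' = S l' := by
      intro n
      have h1 := (hST _).1 (hb n)
      rw [SP, pre_length] at h1
      obtain ⟨y, h2, h3⟩ := h1
      refine ⟨y, h2, fun l' a b => ?_⟩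
      rw [Bool.eq_iff_iff, hST]
      exact h3 l' a b
    choose y h1 h2 using key
    have hy : Tendsto y atTop (nhds b) := by
      rw [tendsto_pi_nhds]
      intro i
      apply tendsto_const_nhds.congr'
      filter_upwards [eventually_gt_atTop i] with n hn
      have := congrArg (fun l : List ℕ => l[i]?) (h1 n)
      simpa [pre, hn] using this.symm
    have hgb : g b = S := by
      funext l
      have h3 := (tendsto_pi_nhds.1 ((hg.tendsto b).comp hy)) l
      have h4 : Tendsto (fun n => (g ∘ y) n l) atTop (nhds (S l)) := by
        apply tendsto_const_nhds.congr'
        filter_upwards [eventually_gt_atTop l.length, eventually_gt_atTop (Encodable.encode l)] with n a b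
        exact (h2 n l a b).symm
      exact tendsto_nhds_unique h3 h4
    have : S ∈ WF := by rw [← hr, ← hgb]; exact ⟨b, rfl⟩
    exact this ⟨b, hb⟩
  have h5 := hmem
  rw [← hr] at h5
  obtain ⟨y, hy⟩ := h5
  apply hmem
  refine ⟨y, fun n => ?_⟩
  rw [hST, SP]
  refine ⟨y, by rw [pre_length], fun l' _ _ => ?_⟩
  rw [hy, hST]

def code (l : List ℕ) : ℕ := Encodable.encode l + 1

lemma code_inj {l l' : List ℕ} (h : code l = code l') : l = l' := by
  unfold code at h
  exact Encodable.encode_injective (by omega)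

lemma fset_clopen (l : List ℕ) : IsClopen {x : TT | x (code l) = 0 ∧ ∀ l' : List ℕ, l' <+: l → l' ≠ l → x (code l') ≠ 0} := by
  have h0 : ∀ l : List ℕ, IsClopen {x : TT | x (code l) = 0} := fun l =>
    (isClopen_discrete ({0} : Set (Fin (2 ^ code l)))).preimage (continuous_apply (code l))
  have : {x : TT | x (code l) = 0 ∧ ∀ l' : List ℕ, l' <+: l → l' ≠ l → x (code l') ≠ 0} =
      {x : TT | x (code l) = 0} ∩ ⋂ l' ∈ l.inits.toFinset.filter (fun l' => l' ≠ l), {x : TT | x (code l') = 0}ᶜ := by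
    ext x
    simp only [Set.mem_inter_iff, Set.mem_iInter, Finset.mem_filter, List.mem_toFinset, List.mem_inits]
    constructor
    · rintro ⟨h1, h2⟩
      exact ⟨h1, fun l' h => h2 l' h.1 h.2⟩
    · rintro ⟨h1, h2⟩
      exact ⟨h1, fun l' a b => h2 l' ⟨a, b⟩⟩
  rw [this]
  exact (h0 l).inter (isClopen_biInter_finset fun l' _ => (h0 l').compl)

def fset (l : List ℕ) : BAlg := ⟨_, fset_clopen l⟩

def Good (S : List ℕ → Bool) (l : List ℕ) : Prop := ∀ l' : List ℕ, l' <+: l → S l' = true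

lemma branch_of (S : List ℕ → Bool) (K : Set ℕ) (hK : K.Infinite)
    (h : ∀ a ∈ K, ∀ b ∈ K, a ≠ b → ∃ l l' : List ℕ, a = code l ∧ b = code l' ∧ Good S l ∧ Good S l' ∧ (l <+: l' ∨ l' <+: l)) :
    ∃ b : ℕ → ℕ, ∀ n, S (pre b n) = true := by
  set L : Set (List ℕ) := code ⁻¹' K with hL
  have hgood : ∀ a ∈ K, ∃ l, a = code l ∧ Good S l := by
    intro a ha
    obtain ⟨b, hb, hne⟩ := hK.exists_notMem_finite (Set.finite_singleton a)
    obtain ⟨l, l', h1, h2, h3, _⟩ := h a ha b hb (fun h => hne h.symm)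
    exact ⟨l, h1, h3⟩
  have hLg : ∀ l ∈ L, Good S l := by
    intro l hl
    obtain ⟨l', h1, h2⟩ := hgood _ hl
    rwa [code_inj h1]
  have hLc : ∀ l ∈ L, ∀ l' ∈ L, l <+: l' ∨ l' <+: l := by
    intro l hl l' hl'
    by_cases hne : l = l'
    · subst hne; exact Or.inl (List.prefix_refl l)
    · obtain ⟨m, m', h1, h2, _, _, h3⟩ := h _ hl _ hl' (fun h => hne (code_inj h))
      rwa [code_inj h1, code_inj h2]
  have hLi : L.Infinite := by
    intro hfin
    apply hK
    refine (hfin.image code).subset ?_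
    intro a ha
    obtain ⟨l, h1, _⟩ := hgood a ha
    exact ⟨l, by rw [hL, Set.mem_preimage, ← h1]; exact ha, h1.symm⟩
  have hlen : (List.length '' L).Infinite := by
    refine hLi.image ?_
    intro l hl l' hl' heq
    rcases hLc l hl l' hl' with h | h
    · exact h.eq_of_length heq
    · exact (h.eq_of_length heq.symm).symm
  have hbig : ∀ n, ∃ l ∈ L, n < l.length := by
    intro n
    obtain ⟨_, ⟨l, hl, rfl⟩, h⟩ := hlen.exists_gt n
    exact ⟨l, hl, h⟩
  choose m hm hlt using hbig
  have hget : ∀ l ∈ L, ∀ l' ∈ L, ∀ i, i < l.length → i < l'.length → l[i]? = l'[i]? := by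
    intro l hl l' hl' i h1 h2
    rcases hLc l hl l' hl' with ⟨t, rfl⟩ | ⟨t, rfl⟩
    · rw [List.getElem?_append_left h1]
    · rw [List.getElem?_append_left h2]
  refine ⟨fun n => (m n)[n]'(hlt n), fun n => ?_⟩
  refine hLg (m n) (hm n) _ ?_
  rw [List.prefix_iff_eq_take, pre_length]
  apply List.ext_getElem?
  intro i
  by_cases hi : i < n
  · rw [List.getElem?_take_of_lt hi, hget _ (hm n) _ (hm i) i (hi.trans (hlt n)) (hlt i)]
    simp [pre, hi, hlt i]
  · rw [List.getElem?_eq_none (by rw [pre_length]; omega), List.getElem?_eq_none (by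
      rw [List.length_take]; omega)]

lemma WF_iff (S : List ℕ → Bool) : S ∈ WF ↔ ∃ f : BAlg → ℝ≥0∞, (IsSubmeasurePt f ∧ IsExhaustivePt f) ∧
    ∀ l, Good S l → 1 ≤ f (fset l) := by
  constructor
  · intro hS
    obtain ⟨f, h1, h2, h3⟩ := exists_sub_rel
      (fun a b => ∃ l l' : List ℕ, a = code l ∧ b = code l' ∧ Good S l ∧ Good S l' ∧ (l <+: l' ∨ l' <+: l))
      (fun K hK h => hS (branch_of S K hK h))
    refine ⟨f, ⟨h1, h2⟩, fun l hl => ?_⟩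
    refine h3 (l.inits.toFinset.image code) ?_
      (fun i => if i = code l then 0 else ⟨2 ^ i - 1, by have := Nat.one_le_two_pow (n := i); omega⟩) (fset l) ?_
    · intro a ha b hb _
      obtain ⟨m, hm, rfl⟩ := Finset.mem_image.1 ha
      obtain ⟨m', hm', rfl⟩ := Finset.mem_image.1 hb
      rw [List.mem_toFinset, List.mem_inits] at hm hm'
      exact ⟨m, m', rfl, rfl, fun l' h => hl l' (h.trans hm), fun l' h => hl l' (h.trans hm'),
        List.prefix_or_prefix_of_prefix hm hm'⟩
    · intro x hx
      have hx' : ∀ l', l' <+: l → _ := fun l' hl' => hx (code l') (Finset.mem_image_of_mem _ (by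
        rw [List.mem_toFinset, List.mem_inits]; exact hl'))
      refine ⟨?_, fun l' h1 h2 => ?_⟩
      · rw [hx' l (List.prefix_refl l)]; simp
      · rw [hx' l' h1]
        beta_reduce
        rw [if_neg (fun h => h2 (code_inj h))]
        intro h
        have := congrArg Fin.val h
        simp only [Fin.val_zero] at this
        have h3 : 2 ^ code l' = 2 * 2 ^ (Encodable.encode l') := by unfold code; rw [pow_succ]; ring
        have := Nat.one_le_two_pow (n := Encodable.encode l')
        omega
  · rintro ⟨f, ⟨_, h2⟩, h3⟩ ⟨b, hb⟩
    have h4 := h2 (fun i => fset (pre b i)) (by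
      have key : ∀ i j, i < j → Disjoint (fset (pre b i)).1 (fset (pre b j)).1 := by
        intro i j hij
        rw [Set.disjoint_left]
        rintro x ⟨h1, _⟩ ⟨_, h2⟩
        refine h2 (pre b i) ?_ ?_ h1
        · rw [List.prefix_iff_eq_take, pre_length, pre_take, min_eq_left hij.le]
        · intro h
          have := congrArg List.length h
          rw [pre_length, pre_length] at this
          omega
      intro i j hij
      rcases lt_or_gt_of_ne hij with h | h
      · exact key i j h
      · exact (key j i h).symm)
    have h5 : (1 : ℝ≥0∞) ≤ 0 := ge_of_tendsto' h4 (fun i => h3 _ (fun l' hl' => by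
      rw [pre_prefix hl']; exact hb _))
    simp at h5

instance : Countable BAlg := by
  have : {X : Set TT | IsClopen X}.Countable := by
    refine Set.Countable.mono (fun X hX => ?_) (Set.countable_iUnion fun n => (finite_Dep n).countable)
    obtain ⟨n, hn⟩ := clopen_dep hX
    exact Set.mem_iUnion.2 ⟨n, hn⟩
  exact this.to_subtype

theorem main : ¬ @MeasurableSet (BAlg → ℝ≥0∞) (borel (BAlg → ℝ≥0∞))
        {f : BAlg → ℝ≥0∞ | IsSubmeasurePt f ∧ IsExhaustivePt f} := by
  intro hE
  have hbor : (borel (BAlg → ℝ≥0∞)) = MeasurableSpace.pi := (BorelSpace.measurable_eq).symm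
  rw [hbor] at hE
  have hA : MeasurableSet {p : (List ℕ → Bool) × (BAlg → ℝ≥0∞) | (IsSubmeasurePt p.2 ∧ IsExhaustivePt p.2) ∧
      ∀ l, Good p.1 l → 1 ≤ p.2 (fset l)} := by
    apply MeasurableSet.inter
    · exact measurable_snd hE
    · refine measurableSet_setOfPred.2 (Measurable.forall fun l => Measurable.imp ?_ ?_)
      · refine Measurable.forall fun l' => Measurable.imp measurable_const ?_
        refine measurableSet_setOfPred.1 ?_
        have hm : Measurable (fun p : (List ℕ → Bool) × (BAlg → ℝ≥0∞) => p.1 l') :=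
          (measurable_pi_apply l').comp measurable_fst
        exact hm (measurableSet_singleton true)
      · refine measurableSet_setOfPred.1 ?_
        have hm : Measurable (fun p : (List ℕ → Bool) × (BAlg → ℝ≥0∞) => p.2 (fset l)) :=
          (measurable_pi_apply (fset l)).comp measurable_snd
        exact hm measurableSet_Ici
  have i0 : PolishSpace Bool := by
    have : Topology.IsClosedEmbedding (fun b : Bool => b.toNat) :=
      Topology.IsClosedEmbedding.of_continuous_injective_isClosedMap continuous_of_discreteTopology
        (fun a b h => by cases a <;> cases b <;> simp_all) (fun _ _ => isClosed_discrete _)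
    exact this.polishSpace
  have i1 : PolishSpace (List ℕ → Bool) := inferInstance
  have i2 : PolishSpace (BAlg → ℝ≥0∞) := inferInstance
  have i3 : PolishSpace ((List ℕ → Bool) × (BAlg → ℝ≥0∞)) := inferInstance
  have h1 := hA.analyticSet.image_of_continuous (continuous_fst)
  apply WF_not_analytic
  convert h1 using 1
  ext S
  rw [WF_iff]
  constructor
  · rintro ⟨f, h1, h2⟩
    exact ⟨(S, f), ⟨h1, h2⟩, rfl⟩
  · rintro ⟨⟨S', f⟩, ⟨h1, h2⟩, rfl⟩
    exact ⟨f, h1, h2⟩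

end Tal

/-- The set `𝓔` of exhaustive submeasures on `ℬ`, as a subset of the product space
`[0,∞]^ℬ` with the product topology, is not Borel. -/
theorem exhaustive_submeasures_not_borel :
    ¬ @MeasurableSet (BAlg → ℝ≥0∞) (borel (BAlg → ℝ≥0∞))
        {f : BAlg → ℝ≥0∞ | IsSubmeasurePt f ∧ IsExhaustivePt f} := by
  exact Tal.main
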